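/- Let q > 2 be even and let U be an intersecting family of polynomials over F_q of degree at most 2. For t ∈ F_q let B_t = {b ∈ F_q : there exists a ∈ F_q with a + bx + (b+t)x^2 ∈ U}, and let Dom = {t ∈ F_q : |B_t| ≥ q − √q/2}. Then there exist α, β ∈ F_q such that every polynomial g = a + bx + cx^2 ∈ U with b + c ∈ Dom satisfies g(α^{q/2}) = β. -/

import Mathlib

open Polynomial

section Biv
variable {F : Type*} [Field F]

/-- total degree at most k -/
def TD (k : ℕ) (p : Polynomial (Polynomial F)) : Prop :=
  ∀ i j, k < i + j → (p.coeff i).coeff j = 0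

lemma TD.mono {k l : ℕ} {p : Polynomial (Polynomial F)} (h : TD k p) (hkl : k ≤ l) : TD l p :=
  fun i j hij => h i j (by omega)

lemma TD.add {k : ℕ} {p r : Polynomial (Polynomial F)} (h : TD k p) (h' : TD k r) :
    TD k (p + r) := fun i j hij => by simp [h i j hij, h' i j hij]

lemma TD.neg {k : ℕ} {p : Polynomial (Polynomial F)} (h : TD k p) :
    TD k (-p) := fun i j hij => by simp [h i j hij]

lemma TD.sub {k : ℕ} {p r : Polynomial (Polynomial F)} (h : TD k p) (h' : TD k r) :
    TD k (p - r) := fun i j hij => by simp [h i j hij, h' i j hij]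

lemma TD.mul {k l : ℕ} {p r : Polynomial (Polynomial F)} (h : TD k p) (h' : TD l r) :
    TD (k + l) (p * r) := fun i j hij => by
  rw [coeff_mul, finsetSum_coeff]
  refine Finset.sum_eq_zero fun x hx => ?_
  rw [coeff_mul]
  refine Finset.sum_eq_zero fun y hy => ?_
  simp only [Finset.HasAntidiagonal.mem_antidiagonal] at hx hy
  by_cases h1 : k < x.1 + y.1
  · rw [h _ _ h1, zero_mul]
  · rw [h' _ _ (by omega), mul_zero]

lemma TD.ofC {k : ℕ} {a : Polynomial F} (h : a.natDegree ≤ k) : TD k (C a) := fun i j hij => by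
  rw [coeff_C]
  split_ifs with h0
  · exact coeff_eq_zero_of_natDegree_lt (by omega)
  · simp

lemma TD.zero (k : ℕ) : TD k (0 : Polynomial (Polynomial F)) := fun i j hij => by simp

lemma TD.one (k : ℕ) : TD k (1 : Polynomial (Polynomial F)) := by
  rw [← C_1]; exact TD.ofC (by simp)

lemma TD.ofX {k : ℕ} (hk : 1 ≤ k) : TD k (X : Polynomial (Polynomial F)) := fun i j hij => by
  rw [coeff_X]
  split_ifs with h0
  · rw [coeff_one, if_neg (by omega)]
  · simp

lemma TD.ofX_pow (k : ℕ) : TD k (X ^ k : Polynomial (Polynomial F)) := fun i j hij => by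
  rw [coeff_X_pow]
  split_ifs with h0
  · rw [coeff_one, if_neg (by omega)]
  · simp

lemma TD.prod {ι : Type*} (s : Finset ι) (k : ℕ) (f : ι → Polynomial (Polynomial F))
    (h : ∀ i ∈ s, TD k (f i)) : TD (s.card * k) (∏ i ∈ s, f i) := by
  classical
  induction s using Finset.induction_on with
  | empty => simpa using TD.one 0
  | insert a s ha ih =>
    rw [Finset.prod_insert ha, Finset.card_insert_of_notMem ha]
    refine ((h a (by simp)).mul (ih fun i hi => h i (by simp [hi]))).mono (le_of_eq (by ring))

lemma TD.derivative {k : ℕ} {p : Polynomial (Polynomial F)} (h : TD k p) (l : ℕ)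
    (hl : k ≤ l + 1) : TD l (derivative p) := fun i j hij => by
  rw [coeff_derivative]
  have : ((i : Polynomial F) + 1) = Polynomial.C ((i : F) + 1) := by simp
  rw [this, coeff_mul_C, h _ _ (by omega), zero_mul]

lemma TD.natDegree_le {k : ℕ} {p : Polynomial (Polynomial F)} (h : TD k p) :
    p.natDegree ≤ k := by
  rw [natDegree_le_iff_coeff_eq_zero]
  intro i hi
  ext j
  simpa using h i j (by omega)

lemma TD.coeff_natDegree_le {k : ℕ} {p : Polynomial (Polynomial F)} (h : TD k p) (i : ℕ) :
    (p.coeff i).natDegree ≤ k - i := by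
  rw [natDegree_le_iff_coeff_eq_zero]
  intro j hj
  exact h i j (by omega)

lemma TD.div_aux {m : ℕ} {R : Polynomial (Polynomial F)} (hR : R.Monic) (hm : R.natDegree = m)
    (hT : TD m R) (k D : ℕ) : ∀ p : Polynomial (Polynomial F), p.degree < D → TD k p →
    ∃ s r : Polynomial (Polynomial F), r + R * s = p ∧ r.degree < R.degree ∧ TD k r ∧
      (∀ i j, k < i + j + m → (s.coeff i).coeff j = 0) := by
  have hRd : R.degree = m := by rw [degree_eq_natDegree hR.ne_zero, hm]
  induction D with
  | zero =>
    intro p hp hk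
    refine ⟨0, p, by simp, ?_, hk, by simp⟩
    rw [hRd]
    exact lt_of_lt_of_le hp (by exact_mod_cast Nat.zero_le m)
  | succ D ih =>
    intro p hp hk
    by_cases hDm : D < m
    · refine ⟨0, p, by simp, ?_, hk, by simp⟩
      rw [hRd]
      exact lt_of_lt_of_le hp (by exact_mod_cast hDm)
    · push Not at hDm
      set s0 : Polynomial (Polynomial F) := monomial (D - m) (p.coeff D) with hs0
      have hs0T : ∀ i j, k < i + j + m → (s0.coeff i).coeff j = 0 := by
        intro i j hij
        rw [hs0, coeff_monomial]
        split_ifs with h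
        · exact hk _ _ (by omega)
        · simp
      have hprod : TD k (R * s0) := by
        by_cases hkm : m ≤ k
        · have : TD (k - m) s0 := fun i j hij => hs0T i j (by omega)
          exact (hT.mul this).mono (by omega)
        · have : s0 = 0 := by
            ext i j
            simpa using hs0T i j (by omega)
          rw [this, mul_zero]; exact TD.zero k
      have hdeg : (p - R * s0).degree < D := by
        rw [degree_lt_iff_coeff_zero]
        intro i hi
        obtain ⟨e, rfl⟩ : ∃ e, i = e + (D - m) := ⟨i - (D - m), by omega⟩
        rw [coeff_sub, hs0, coeff_mul_monomial]
        rcases Nat.eq_or_lt_of_le hi with h | h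
        · have : e = m := by omega
          have h2 : R.coeff m = 1 := by rw [← hm]; exact hR
          rw [← h, this, h2, one_mul, sub_self]
        · rw [coeff_eq_zero_of_natDegree_lt (p := R) (by omega), zero_mul, sub_zero]
          exact coeff_eq_zero_of_degree_lt (lt_of_lt_of_le hp (by exact_mod_cast h))
      obtain ⟨s, r, h1, h2, h3, h4⟩ := ih (p - R * s0) hdeg (hk.sub hprod)
      refine ⟨s + s0, r, ?_, h2, h3, ?_⟩
      · rw [mul_add, ← add_assoc, h1]; ring
      · intro i j hij
        simp [h4 i j hij, hs0T i j hij]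

lemma TD.divMod {m k : ℕ} {R p : Polynomial (Polynomial F)} (hR : R.Monic) (hm : R.natDegree = m)
    (hT : TD m R) (hp : TD k p) :
    TD k (p %ₘ R) ∧ (∀ i j, k < i + j + m → ((p /ₘ R).coeff i).coeff j = 0) := by
  obtain ⟨s, r, h1, h2, h3, h4⟩ := TD.div_aux hR hm hT k (p.natDegree + 1) p
    (lt_of_le_of_lt degree_le_natDegree (by exact_mod_cast Nat.lt_succ_self _)) hp
  obtain ⟨h5, h6⟩ := div_modByMonic_unique s r hR ⟨h1, h2⟩
  rw [h5, h6]
  exact ⟨h3, h4⟩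

/-- homogenisation in the chart X = Z/t, Y = 1/t -/
noncomputable def hom (k : ℕ) (p : Polynomial (Polynomial F)) : Polynomial (Polynomial F) :=
  ∑ i ∈ Finset.range (k + 1), monomial i (reflect (k - i) (p.coeff i))

lemma coeff_hom (k : ℕ) (p : Polynomial (Polynomial F)) (i : ℕ) :
    (hom k p).coeff i = if i ≤ k then reflect (k - i) (p.coeff i) else 0 := by
  rw [hom, finsetSum_coeff]
  simp only [coeff_monomial]
  rw [Finset.sum_ite_eq' ]
  simp

lemma hom_add (k : ℕ) (p r : Polynomial (Polynomial F)) : hom k (p + r) = hom k p + hom k r := by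
  ext1 i
  simp only [coeff_hom, coeff_add]
  split_ifs <;> simp [reflect_add]

lemma hom_TD (k : ℕ) (p : Polynomial (Polynomial F)) (hp : TD k p) : TD k (hom k p) := by
  intro i j hij
  rw [coeff_hom]
  split_ifs with h
  · rw [coeff_reflect]
    by_cases hj : j ≤ k - i
    · omega
    · rw [revAt_eq_self_of_lt (by omega)]
      exact hp _ _ hij
  · simp

lemma reflect_sum' {ι : Type*} (s : Finset ι) (N : ℕ) (f : ι → Polynomial F) :
    reflect N (∑ i ∈ s, f i) = ∑ i ∈ s, reflect N (f i) := by
  classical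
  induction s using Finset.induction_on with
  | empty => simp
  | insert a s ha ih => rw [Finset.sum_insert ha, reflect_add, ih, Finset.sum_insert ha]

lemma hom_mul {k l : ℕ} {p r : Polynomial (Polynomial F)} (hp : TD k p) (hr : TD l r) :
    hom (k + l) (p * r) = hom k p * hom l r := by
  ext1 m
  rw [coeff_mul, coeff_hom]
  split_ifs with h
  · rw [coeff_mul, reflect_sum']
    refine Finset.sum_congr rfl fun x hx => ?_
    rw [Finset.HasAntidiagonal.mem_antidiagonal] at hx
    rw [coeff_hom, coeff_hom]
    by_cases h1 : x.1 ≤ k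
    · by_cases h2 : x.2 ≤ l
      · rw [if_pos h1, if_pos h2, ← reflect_mul _ _ (hp.coeff_natDegree_le _)
          (hr.coeff_natDegree_le _)]
        congr 1
        omega
      · rw [if_neg h2, coeff_eq_zero_of_natDegree_lt (p := r)
          (lt_of_le_of_lt hr.natDegree_le (by omega))]
        simp
    · rw [if_neg h1, coeff_eq_zero_of_natDegree_lt (p := p)
          (lt_of_le_of_lt hp.natDegree_le (by omega))]
      simp
  · symm
    refine Finset.sum_eq_zero fun x hx => ?_
    rw [Finset.HasAntidiagonal.mem_antidiagonal] at hx
    rw [coeff_hom, coeff_hom]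
    by_cases h1 : x.1 ≤ k
    · rw [if_neg (show ¬ x.2 ≤ l by omega), mul_zero]
    · rw [if_neg h1, zero_mul]

lemma hom_derivative {k : ℕ} (p : Polynomial (Polynomial F)) (hk : 1 ≤ k) :
    hom (k - 1) (derivative p) = derivative (hom k p) := by
  ext1 i
  rw [coeff_derivative, coeff_hom, coeff_hom, coeff_derivative]
  have : ((i : Polynomial F) + 1) = Polynomial.C ((i : F) + 1) := by simp
  rw [this]
  by_cases h : i ≤ k - 1
  · rw [if_pos h, if_pos (by omega)]
    rw [mul_comm, reflect_C_mul, mul_comm]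
    congr 2
    omega
  · rw [if_neg h, if_neg (by omega), zero_mul]

lemma hom_C_mul_X_pow (k i : ℕ) (a : Polynomial F) (hi : i ≤ k) :
    hom k (C a * X ^ i) = C (reflect (k - i) a) * X ^ i := by
  ext1 j
  rw [coeff_hom, coeff_C_mul_X_pow, coeff_C_mul_X_pow]
  by_cases h : j = i
  · subst h; simp [hi]
  · simp [h]

lemma hom_C (k : ℕ) (a : Polynomial F) :
    hom k (C a) = C (reflect k a) := by
  have := hom_C_mul_X_pow k 0 a (by omega)
  simpa using this

/-- raising the homogenisation degree -/
lemma hom_shift {k : ℕ} (l : ℕ) {p : Polynomial (Polynomial F)} (hp : TD k p) :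
    hom (k + l) p = C (X ^ l) * hom k p := by
  have h := hom_mul (F := F) hp (TD.one l)
  rw [mul_one] at h
  rw [h, mul_comm]
  congr 1
  rw [← C_1, hom_C]
  congr 1
  have := reflect_C (R := F) 1 l
  simp

end Biv

set_option linter.unusedSectionVars false

lemma X_pow_sub_X_eq_prod (F : Type*) [Field F] [Fintype F] :
    (X ^ Fintype.card F - X : Polynomial F) = ∏ a : F, (X - C a) := by
  have h2 := FiniteField.roots_X_pow_card_sub_X F
  have h3 : (X ^ Fintype.card F - X : Polynomial F).Monic := by
    apply monic_X_pow_sub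
    rw [degree_X]
    exact_mod_cast Fintype.one_lt_card
  have h4 := prod_multiset_X_sub_C_of_monic_of_roots_card_eq h3 (by
    rw [h2, FiniteField.X_pow_card_sub_X_natDegree_eq F Fintype.one_lt_card]
    simp [Finset.card_univ])
  rw [← h4, h2]
  rfl

section TracePoly
variable {F : Type*} [Field F] [CharP F 2]

/-- the trace polynomial -/
noncomputable def Tp (F : Type*) [Field F] (N : ℕ) : Polynomial F :=
  ∑ j ∈ Finset.range N, X ^ (2 ^ j)

lemma two_P : (2 : Polynomial F) = 0 := CharTwo.two_eq_zero
lemma two_PP : (2 : Polynomial (Polynomial F)) = 0 := CharTwo.two_eq_zero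

lemma Tp_sq (N : ℕ) : (Tp F N) ^ 2 + Tp F N = X ^ (2 ^ N) + X := by
  induction N with
  | zero => simp [Tp, CharTwo.add_self_eq_zero]
  | succ N ih =>
    have h : Tp F (N + 1) = Tp F N + X ^ (2 ^ N) := by simp [Tp, Finset.sum_range_succ]
    rw [h, pow_succ 2 N, pow_mul]
    linear_combination ih + (Tp F N * X ^ (2 ^ N) + X ^ (2 ^ N)) * two_P (F := F)

lemma Tp_derivative (N : ℕ) (hN : 1 ≤ N) : derivative (Tp F N) = 1 := by
  obtain ⟨M, rfl⟩ : ∃ M, N = M + 1 := ⟨N - 1, by omega⟩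
  rw [Tp, Finset.sum_range_succ']
  simp [derivative_X_pow, CharTwo.two_eq_zero]

lemma Tp_natDegree (N : ℕ) (hN : 1 ≤ N) : (Tp F N).natDegree = 2 ^ (N - 1) := by
  obtain ⟨M, rfl⟩ : ∃ M, N = M + 1 := ⟨N - 1, by omega⟩
  have hq : ∀ M, (Tp F (M + 1)).natDegree = 2 ^ M ∧ (Tp F (M + 1)).natDegree = 2 ^ M := by
    intro M
    induction M with
    | zero => simp [Tp]
    | succ M ih =>
      have h : Tp F (M + 1 + 1) = Tp F (M + 1) + X ^ (2 ^ (M + 1)) := by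
        simp [Tp, Finset.sum_range_succ]
      have : (Tp F (M + 1 + 1)).natDegree = 2 ^ (M + 1) := by
        rw [h, natDegree_add_eq_right_of_natDegree_lt]
        · simp
        · rw [ih.1, natDegree_X_pow]; exact Nat.pow_lt_pow_right (by norm_num) (by omega)
      exact ⟨this, this⟩
  simpa using (hq M).1

/-- trace function -/
def tr (N : ℕ) (x : F) : F := ∑ j ∈ Finset.range N, x ^ (2 ^ j)

lemma Tp_eval (N : ℕ) (x : F) : (Tp F N).eval x = tr N x := by
  simp [Tp, tr, eval_finsetSum]

lemma tr_add (N : ℕ) (x y : F) : tr N (x + y) = tr N x + tr N y := by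
  simp only [tr, ← Finset.sum_add_distrib]
  exact Finset.sum_congr rfl fun j _ => add_pow_char_pow x y 2 j

lemma tr_zero (N : ℕ) : tr N (0 : F) = 0 := by
  simp [tr]

variable [Fintype F]

lemma frob {N : ℕ} (hcard : Fintype.card F = 2 ^ N) (x : F) : x ^ (2 ^ N) = x := by
  rw [← hcard]; exact FiniteField.pow_card x

lemma tr_sq_add {N : ℕ} (hcard : Fintype.card F = 2 ^ N) (x : F) : (tr N x) ^ 2 + tr N x = 0 := by
  have := congrArg (eval x) (Tp_sq (F := F) N)
  simp only [eval_add, eval_pow, eval_X, Tp_eval] at this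
  rw [this, frob hcard, CharTwo.add_self_eq_zero]

lemma tr_zero_or_one {N : ℕ} (hcard : Fintype.card F = 2 ^ N) (x : F) : tr N x = 0 ∨ tr N x = 1 := by
  have h := tr_sq_add hcard x
  have : tr N x * (tr N x - 1) = 0 := by
    linear_combination h - (tr N x) * (CharTwo.two_eq_zero : (2 : F) = 0)
  rcases mul_eq_zero.1 this with h | h
  · exact Or.inl h
  · exact Or.inr (sub_eq_zero.1 h)

lemma tr_sq {N : ℕ} (hcard : Fintype.card F = 2 ^ N) (x : F) : tr N (x ^ 2) = tr N x := by
  have h : tr N (x ^ 2) = (tr N x) ^ 2 := by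
    simp only [tr]
    rw [sum_pow_char]
    exact Finset.sum_congr rfl fun j _ => by rw [← pow_mul, ← pow_mul, mul_comm]
  rw [h]
  linear_combination tr_sq_add hcard x - (tr N x) * (CharTwo.two_eq_zero : (2 : F) = 0)

lemma tr_artin {N : ℕ} (hcard : Fintype.card F = 2 ^ N) (x : F) : tr N (x + x ^ 2) = 0 := by
  rw [tr_add, tr_sq hcard, CharTwo.add_self_eq_zero]

/-- vanishing on trace-one elements -/
lemma Tp_add_one_dvd {N : ℕ} (hcard : Fintype.card F = 2 ^ N)
    (hN : 1 ≤ N) (g : Polynomial F) (hg : ∀ d : F, tr N d = 1 → g.eval d = 0) :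
    Tp F N + 1 ∣ g := by
  have h1 : (X ^ Fintype.card F - X : Polynomial F) ∣ Tp F N * g := by
    rw [X_pow_sub_X_eq_prod]
    refine Finset.prod_dvd_of_coprime (fun a _ b _ hab => isCoprime_X_sub_C_of_isUnit_sub ?_) ?_
    · exact (sub_ne_zero.2 hab).isUnit
    · intro a _
      rw [dvd_iff_isRoot, IsRoot, eval_mul, Tp_eval]
      rcases tr_zero_or_one hcard a with h | h
      · rw [h, zero_mul]
      · rw [hg a h, mul_zero]
  have h2 : (X ^ Fintype.card F - X : Polynomial F) = Tp F N * (Tp F N + 1) := by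
    rw [hcard]
    linear_combination -(Tp_sq (F := F) N) - X * two_P (F := F)
  rw [h2] at h1
  have hT : Tp F N ≠ 0 := by
    intro h
    have := Tp_derivative (F := F) N hN
    rw [h] at this
    simp at this
  exact (mul_dvd_mul_iff_left hT).1 h1

lemma tr_count {N : ℕ} (hcard : Fintype.card F = 2 ^ N) (hN : 1 ≤ N) (c k : F) (s : Finset F) (hs : 2 ^ (N - 1) < s.card)
    (h : ∀ y ∈ s, tr N (c * y + k) = 0) : c = 0 := by
  by_contra hc
  have hdeg : ((Tp F N).comp (C c * X + C k)).natDegree = 2 ^ (N - 1) := by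
    rw [natDegree_comp, Tp_natDegree N hN, natDegree_linear hc, mul_one]
  have hne : (Tp F N).comp (C c * X + C k) ≠ 0 := by
    intro h0
    rw [h0, natDegree_zero] at hdeg
    exact absurd hdeg (by positivity)
  have : s.card ≤ ((Tp F N).comp (C c * X + C k)).natDegree := by
    apply Polynomial.card_le_degree_of_subset_roots
    intro y hy
    rw [mem_roots hne, IsRoot, eval_comp, Tp_eval]
    simpa using h y hy
  omega

end TracePoly

section Ext
variable {F : Type*} [Field F] [CharP F 2] [Fintype F] [DecidableEq F]

/-- Redei polynomial -/
noncomputable def Rp (B : Finset F) (φ : F → F) : Polynomial (Polynomial F) :=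
  ∏ y ∈ B, (X + C (C y * X + C (φ y)))

lemma Rp_monic (B : Finset F) (φ : F → F) : (Rp B φ).Monic :=
  monic_prod_of_monic _ _ fun y _ => monic_X_add_C _

lemma Rp_natDegree (B : Finset F) (φ : F → F) : (Rp B φ).natDegree = B.card := by
  rw [Rp, natDegree_prod_of_monic _ _ fun y _ => monic_X_add_C _]
  simp only [natDegree_X_add_C]
  simp

lemma TD_line (y a : F) : TD 1 (X + C (C y * X + C a)) :=
  (TD.ofX le_rfl).add (TD.ofC (natDegree_linear_le))

lemma Rp_TD (B : Finset F) (φ : F → F) : TD B.card (Rp B φ) := by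
  have := TD.prod B 1 (fun y => (X + C (C y * X + C (φ y)) : Polynomial (Polynomial F)))
    (fun y _ => TD_line y _)
  simpa [Rp] using this

lemma reflect_line (y a : F) : reflect 1 (C y * X + C a) = C y + C a * X := by
  rw [reflect_add, reflect_C_mul]
  have h1 : reflect 1 (X : Polynomial F) = 1 := by
    have := reflect_one_X (R := F)
    simpa using this
  have h2 := reflect_C (R := F) a 1
  rw [h1, h2]; simp

lemma hom_X (k : ℕ) : hom k (X ^ k : Polynomial (Polynomial F)) = X ^ k := by
  have := hom_C_mul_X_pow k k (1 : Polynomial F) le_rfl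
  rw [C_1, one_mul] at this
  rw [this]
  simp

lemma hom_line (y a : F) :
    hom 1 (X + C (C y * X + C a)) = X + C (C a * X + C y) := by
  rw [hom_add, hom_C, reflect_line]
  have := hom_X (F := F) 1
  rw [pow_one] at this
  rw [this, add_comm (C y)]

lemma hom_Rp (B : Finset F) (φ : F → F) :
    hom B.card (Rp B φ) = ∏ y ∈ B, (X + C (C (φ y) * X + C y)) := by
  induction B using Finset.induction_on with
  | empty => simpa [Rp] using hom_X (F := F) 0
  | insert a s ha ih =>
    have : Rp (insert a s) φ = Rp s φ * (X + C (C a * X + C (φ a))) := by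
      rw [Rp, Finset.prod_insert ha, mul_comm]; rfl
    rw [this, Finset.card_insert_of_notMem ha, hom_mul (Rp_TD s φ) (TD_line _ _), ih, hom_line,
      Finset.prod_insert ha, mul_comm]

lemma hom_degree_lt {k : ℕ} {p : Polynomial (Polynomial F)} {m : ℕ} (hp : p.degree < m) :
    (hom k p).degree < m := by
  rw [degree_lt_iff_coeff_zero] at *
  intro i hi
  rw [coeff_hom, hp i hi]; simp

lemma map_degree_lt {p : Polynomial (Polynomial F)} {m : ℕ} (d : F) (hp : p.degree < m) :
    (p.map (evalRingHom d)).degree < m := by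
  rw [degree_lt_iff_coeff_zero] at *
  intro i hi
  rw [coeff_map, hp i hi]; simp

lemma zero_of_monic_dvd {A : Type*} [CommRing A] {p r : Polynomial A} {m : ℕ}
    (hp : p.Monic) (hpm : p.natDegree = m) (hr : r.degree < m) (h : p ∣ r) : r = 0 := by
  by_contra h0
  have hnt : Nontrivial A := by
    by_contra hn
    rw [not_nontrivial_iff_subsingleton] at hn
    exact h0 (Subsingleton.elim _ _)
  refine hp.not_dvd_of_degree_lt h0 ?_ h
  rwa [degree_eq_natDegree hp.ne_zero, hpm]

lemma L1 {N : ℕ} (hcard : Fintype.card F = 2 ^ N) (hN : 2 ≤ N)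
    (B : Finset F) (φ : F → F) (hB : ∀ x ∈ B, ∀ y ∈ B, x ≠ y → tr N ((φ x + φ y) / (x + y)) = 0)
    (hB2 : 2 ≤ B.card) :
    ∃ H K : Polynomial (Polynomial F), Rp B φ * H = X ^ (2 ^ N) + X + C (Tp F N + 1) * K ∧
      H.Monic ∧ H.natDegree = Bᶜ.card ∧ TD Bᶜ.card H ∧ TD (2 ^ (N - 1)) K ∧
      (hom Bᶜ.card H).map (evalRingHom 0) = ∏ ε ∈ Bᶜ, (X + C ε) := by
  have hbn : B.card + Bᶜ.card = 2 ^ N := by rw [← hcard]; exact Finset.card_add_card_compl B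
  set b := B.card with hb
  set n := Bᶜ.card with hn
  set R := Rp B φ with hR
  have hRm : R.Monic := Rp_monic B φ
  have hRd : R.natDegree = b := Rp_natDegree B φ
  have hRD : R.degree = b := by rw [degree_eq_natDegree hRm.ne_zero, hRd]
  set H := (X ^ (2 ^ N) : Polynomial (Polynomial F)) /ₘ R with hH
  set r := (X ^ (2 ^ N) : Polynomial (Polynomial F)) %ₘ R with hr
  have hdiv : r + R * H = X ^ (2 ^ N) := modByMonic_add_div _ R
  have hrdeg : r.degree < b := by rw [← hRD]; exact degree_modByMonic_lt _ hRm
  obtain ⟨hrT, hHT⟩ := TD.divMod (k := 2 ^ N) (p := X ^ (2 ^ N)) hRm hRd (Rp_TD B φ)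
    (TD.ofX_pow _)
  have hXdeg : (X : Polynomial (Polynomial F)).degree < b := by
    rw [degree_X]; exact_mod_cast (by omega : 1 < b)
  have hXdeg' : (X : Polynomial F).degree < b := by
    rw [degree_X]; exact_mod_cast (by omega : 1 < b)
  have hrX : (r + X).degree < ((b : ℕ) : WithBot ℕ) := lt_of_le_of_lt (degree_add_le _ _) (max_lt hrdeg hXdeg)
  have key : ∀ d : F, tr N d = 1 → (r + X).map (evalRingHom d) = 0 := by
    intro d hd
    have hmon : (R.map (evalRingHom d)).Monic := hRm.map _
    refine zero_of_monic_dvd (m := b) hmon (by rw [hRm.natDegree_map, hRd])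
      (map_degree_lt d hrX) ?_
    have hRe : R.map (evalRingHom d) = ∏ y ∈ B, (X + C (y * d + φ y)) := by
      rw [hR, Rp, Polynomial.map_prod]
      refine Finset.prod_congr rfl fun y _ => ?_
      simp
    have h1 : R.map (evalRingHom d) ∣ X ^ (2 ^ N) - X := by
      rw [← hcard, X_pow_sub_X_eq_prod, hRe]
      have hinj : Set.InjOn (fun y => y * d + φ y) B := by
        intro x hx y hy hxy
        by_contra hne
        have h0 := hB x hx y hy hne
        have hs : x + y ≠ 0 := by
          rw [← CharTwo.sub_eq_add]; exact sub_ne_zero.2 hne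
        have : (φ x + φ y) / (x + y) = d := by
          rw [div_eq_iff hs]
          simp only at hxy
          linear_combination hxy + (φ y - x * d) * (CharTwo.two_eq_zero : (2 : F) = 0)
        rw [this, hd] at h0
        exact one_ne_zero h0
      have : ∏ y ∈ B, (X + C (y * d + φ y)) = ∏ z ∈ B.image (fun y => y * d + φ y), (X - C z) := by
        rw [Finset.prod_image hinj]
        refine Finset.prod_congr rfl fun y _ => ?_
        rw [CharTwo.sub_eq_add]
      rw [this]
      exact Finset.prod_dvd_prod_of_subset _ _ _ (Finset.subset_univ _)
    have h2 : (r + X).map (evalRingHom d) =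
        (X ^ (2 ^ N) - X) - R.map (evalRingHom d) * H.map (evalRingHom d) := by
      have := congrArg (Polynomial.map (evalRingHom d)) hdiv
      simp only [Polynomial.map_add, Polynomial.map_mul, Polynomial.map_pow, map_X] at this ⊢
      linear_combination this + X * two_P (F := F)
    rw [h2]
    exact dvd_sub h1 (dvd_mul_right _ _)
  have hdvd : C (Tp F N + 1) ∣ r + X := by
    rw [C_dvd_iff_dvd_coeff]
    intro i
    refine Tp_add_one_dvd hcard (by omega) _ fun d hd => ?_
    have := congrArg (fun p => coeff p i) (key d hd)
    simp only [coeff_map, coe_evalRingHom, coeff_zero] at this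
    exact this
  obtain ⟨K, hK⟩ := hdvd
  have hT1 : (Tp F N + 1).natDegree = 2 ^ (N - 1) := by
    rw [← C_1, natDegree_add_C, Tp_natDegree N (by omega)]
  have hT1ne : Tp F N + 1 ≠ 0 := by
    intro h
    rw [h, natDegree_zero] at hT1
    exact absurd hT1 (by positivity)
  have hpow : 2 ^ N = 2 ^ (N - 1) + 2 ^ (N - 1) := by
    obtain ⟨M, rfl⟩ : ∃ M, N = M + 1 := ⟨N - 1, by omega⟩
    simp [pow_succ]; ring
  have hRHeq : R * H = X ^ (2 ^ N) + X + C (Tp F N + 1) * K := by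
    rw [← hK]
    linear_combination hdiv - (X + r) * two_PP (F := F)
  have hXR : (X ^ (2 ^ N) : Polynomial (Polynomial F)).Monic := monic_X_pow _
  have hHdeg : H.natDegree = n := by
    rw [hH, natDegree_divByMonic _ hRm, hRd, natDegree_X_pow]; omega
  have hRH_mon : (R * H).Monic := by
    have : R * H = X ^ (2 ^ N) - r := by rw [← hdiv]; ring
    rw [this]
    apply monic_X_pow_sub
    exact lt_of_lt_of_le hrdeg (by exact_mod_cast (by omega : b ≤ 2 ^ N))
  have hHm : H.Monic := hRm.of_mul_monic_left hRH_mon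
  refine ⟨H, K, hRHeq, hHm, hHdeg, fun i j hij => hHT i j (by omega), ?_, ?_⟩
  · intro i j hij
    by_cases h0 : K.coeff i = 0
    · rw [h0, coeff_zero]
    · have hT : TD (2 ^ N) (r + X) := hrT.add (TD.ofX (by omega))
      rw [hK] at hT
      have h3 : ((Tp F N + 1) * K.coeff i).natDegree = 2 ^ (N - 1) + (K.coeff i).natDegree := by
        rw [natDegree_mul hT1ne h0, hT1]
      by_contra hne
      have h4 : j ≤ (K.coeff i).natDegree := le_natDegree_of_ne_zero hne
      have h5 := hT i (2 ^ (N - 1) + (K.coeff i).natDegree) (by omega)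
      rw [coeff_C_mul, ← h3, coeff_natDegree, leadingCoeff_eq_zero] at h5
      exact mul_ne_zero hT1ne h0 h5
  · have hHT' : TD n H := fun i j hij => hHT i j (by omega)
    have h6 : hom (2 ^ N) (R * H) + hom (2 ^ N) r = X ^ (2 ^ N) := by
      rw [← hom_add, add_comm, hdiv, hom_X]
    rw [← hbn, hom_mul (Rp_TD B φ) hHT', hbn, hom_Rp] at h6
    have h7 := congrArg (Polynomial.map (evalRingHom 0)) h6
    simp only [Polynomial.map_add, Polynomial.map_mul, Polynomial.map_pow, map_X,
      Polynomial.map_prod, map_C, coe_evalRingHom, eval_add, eval_mul, eval_C, eval_X, mul_zero,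
      zero_add] at h7
    have h8 := X_pow_sub_X_eq_prod F
    rw [hcard, ← Finset.prod_mul_prod_compl B] at h8
    simp only [CharTwo.sub_eq_add] at h8
    set R0 : Polynomial F := ∏ y ∈ B, (X + C y) with hR0
    have hR0m : R0.Monic := monic_prod_of_monic _ _ fun y _ => monic_X_add_C _
    have hR0d : R0.natDegree = b := by
      rw [hR0, natDegree_prod_of_monic _ _ fun y _ => monic_X_add_C _]
      simp [hb]
    have h9 : R0 * ((hom n H).map (evalRingHom 0) - ∏ ε ∈ Bᶜ, (X + C ε)) =
        - ((hom (2 ^ N) r).map (evalRingHom 0) + X) := by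
      linear_combination h7 + h8
    have h10 : ((hom (2 ^ N) r).map (evalRingHom 0) + X).degree < ((b : ℕ) : WithBot ℕ) :=
      lt_of_le_of_lt (degree_add_le _ _) (max_lt (map_degree_lt 0 (hom_degree_lt hrdeg)) hXdeg')
    have h11 := zero_of_monic_dvd hR0m hR0d h10 (by rw [← dvd_neg, ← h9]; exact dvd_mul_right _ _)
    rw [h11, neg_zero] at h9
    rcases mul_eq_zero.1 h9 with h | h
    · exact absurd h hR0m.ne_zero
    · exact sub_eq_zero.1 h
end Ext

section Der
variable {F : Type*} [Field F]

/-- differentiate the coefficients -/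
noncomputable def dY (p : Polynomial (Polynomial F)) : Polynomial (Polynomial F) :=
  letI : Differential (Polynomial F) := ⟨(derivative' (R := F)).restrictScalars ℤ⟩
  Differential.mapCoeffs p

lemma coeff_dY (p : Polynomial (Polynomial F)) (i : ℕ) :
    (dY p).coeff i = derivative (p.coeff i) := by
  letI : Differential (Polynomial F) := ⟨(derivative' (R := F)).restrictScalars ℤ⟩
  exact Differential.coeff_mapCoeffs p i

lemma dY_mul (p r : Polynomial (Polynomial F)) : dY (p * r) = p * dY r + r * dY p := by
  letI : Differential (Polynomial F) := ⟨(derivative' (R := F)).restrictScalars ℤ⟩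
  have := (Differential.mapCoeffs (A := Polynomial F)).leibniz p r
  simp only [smul_eq_mul] at this
  exact this

lemma dY_add (p r : Polynomial (Polynomial F)) : dY (p + r) = dY p + dY r := by
  ext i : 1
  simp [coeff_dY]

lemma dY_C (a : Polynomial F) : dY (C a) = C (derivative a) := by
  ext i : 1
  rw [coeff_dY, coeff_C, coeff_C]
  split_ifs <;> simp

lemma dY_X_pow (k : ℕ) : dY (X ^ k : Polynomial (Polynomial F)) = 0 := by
  ext i : 1
  rw [coeff_dY, coeff_X_pow]
  split_ifs <;> simp

lemma dY_X : dY (X : Polynomial (Polynomial F)) = 0 := by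
  simpa using dY_X_pow (F := F) 1

lemma dY_one : dY (1 : Polynomial (Polynomial F)) = 0 := by
  simpa using dY_X_pow (F := F) 0

lemma TD.dY {k : ℕ} {p : Polynomial (Polynomial F)} (h : TD k p) (l : ℕ) (hl : k ≤ l + 1) :
    TD l (dY p) := fun i j hij => by
  rw [coeff_dY, coeff_derivative, h i (j + 1) (by omega), zero_mul]

/-- the derivation K d/dX + T d/dY -/
noncomputable def Dv (K : Polynomial (Polynomial F)) (T : Polynomial F)
    (p : Polynomial (Polynomial F)) : Polynomial (Polynomial F) :=
  K * derivative p + C T * dY p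

lemma Dv_mul (K : Polynomial (Polynomial F)) (T : Polynomial F)
    (p r : Polynomial (Polynomial F)) : Dv K T (p * r) = p * Dv K T r + r * Dv K T p := by
  simp only [Dv, derivative_mul, dY_mul]; ring

lemma Dv_line (K : Polynomial (Polynomial F)) (T : Polynomial F) (y a : F) :
    Dv K T (X + C (C y * X + C a)) = K + C (C y * T) := by
  simp only [Dv, derivative_add, derivative_X, derivative_C, dY_add, dY_X, dY_C, C_mul,
    derivative_mul, C_add, dY_mul]
  simp
  ring

lemma Dv_prod (K : Polynomial (Polynomial F)) (T : Polynomial F) {ι : Type*} (s : Finset ι)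
    (f : ι → Polynomial (Polynomial F)) (h : ∀ i ∈ s, f i ∣ Dv K T (f i)) :
    (∏ i ∈ s, f i) ∣ Dv K T (∏ i ∈ s, f i) := by
  classical
  induction s using Finset.induction_on with
  | empty => simp
  | insert a s ha ih =>
    rw [Finset.prod_insert ha, Dv_mul]
    refine dvd_add (mul_dvd_mul_left _ (ih fun i hi => h i (Finset.mem_insert_of_mem hi))) ?_
    rw [mul_comm (f a)]
    exact mul_dvd_mul_left _ (h a (Finset.mem_insert_self _ _))

end Der

section Ext2
variable {F : Type*} [Field F] [CharP F 2] [Fintype F] [DecidableEq F]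

lemma L2 {N : ℕ} (hcard : Fintype.card F = 2 ^ N) (hN : 2 ≤ N)
    (B : Finset F) (φ : F → F) (hn1 : 1 ≤ Bᶜ.card)
    (H K : Polynomial (Polynomial F))
    (hRH : Rp B φ * H = X ^ (2 ^ N) + X + C (Tp F N + 1) * K)
    (hHm : H.Monic) (hHd : H.natDegree = Bᶜ.card) (hHT : TD Bᶜ.card H)
    (hKT : TD (2 ^ (N - 1)) K) :
    ∃ G M L : Polynomial (Polynomial F), TD (Bᶜ.card - 1) M ∧
      hom Bᶜ.card H * G = X ^ (2 ^ N) * derivative (hom Bᶜ.card H) + M +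
        C (X ^ (2 ^ (N - 1))) * L := by
  have hbn : B.card + Bᶜ.card = 2 ^ N := by rw [← hcard]; exact Finset.card_add_card_compl B
  set b := B.card with hb
  set n := Bᶜ.card with hn
  set R := Rp B φ with hR
  set T := Tp F N with hT
  have hRm : R.Monic := Rp_monic B φ
  have hRd : R.natDegree = b := Rp_natDegree B φ
  have hRD : R.degree = b := by rw [degree_eq_natDegree hRm.ne_zero, hRd]
  have two := two_PP (F := F)
  have hTd : T.natDegree = 2 ^ (N - 1) := Tp_natDegree N (by omega)
  have hT1 : (T + 1).natDegree = 2 ^ (N - 1) := by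
    rw [← C_1, natDegree_add_C, hTd]
  have hT1ne : T + 1 ≠ 0 := by
    intro h
    rw [h, natDegree_zero] at hT1
    exact absurd hT1 (by positivity)
  have hpow : 2 ^ N = 2 ^ (N - 1) + 2 ^ (N - 1) := by
    obtain ⟨M, rfl⟩ : ∃ M, N = M + 1 := ⟨N - 1, by omega⟩
    simp [pow_succ]; ring
  have hpos : 1 ≤ 2 ^ (N - 1) := Nat.one_le_two_pow
  have hTsq : T ^ 2 + T = X ^ (2 ^ N) + X := Tp_sq N
  have ha : ∀ y ∈ B, (X + C (C y * X + C (φ y)) : Polynomial (Polynomial F)) ∣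
      K + C (C y * T) := by
    intro y hy
    have h0 := congrArg (eval (C y * X + C (φ y))) hRH
    have hR0 : eval (C y * X + C (φ y)) R = 0 := by
      rw [hR, Rp, eval_prod]
      refine Finset.prod_eq_zero hy ?_
      simp [CharTwo.add_self_eq_zero]
    simp only [eval_mul, hR0, zero_mul, eval_add, eval_pow, eval_X, eval_C] at h0
    rw [add_pow_char_pow, mul_pow, ← C_pow, ← C_pow, frob hcard, frob hcard] at h0
    rw [← CharTwo.sub_eq_add, dvd_iff_isRoot, IsRoot, eval_add, eval_C]
    have : (T + 1) * (eval (C y * X + C (φ y)) K + C y * T) = 0 := by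
      linear_combination -h0 + C y * hTsq - C (φ y) * two_P (F := F)
    exact (mul_eq_zero.1 this).resolve_left hT1ne
  have hRDR : R ∣ Dv K T R := by
    refine Dv_prod K T B _ fun y hy => ?_
    rw [Dv_line]
    exact ha y hy
  obtain ⟨P, hP⟩ := hRDR
  have hprod : Dv K T (R * H) = C (T + 1) * (K + (K * derivative K + C T * dY K)) := by
    rw [hRH]
    have hd : derivative T = 1 := Tp_derivative N (by omega)
    have hz : derivative (X ^ (2 ^ N) : Polynomial (Polynomial F)) = 0 := by
      rw [derivative_X_pow]
      have : ((2 ^ N : ℕ) : Polynomial F) = 0 := by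
        push_cast
        rw [two_P, zero_pow (by omega)]
      rw [this]; simp
    simp only [Dv, derivative_add, derivative_mul, hz, derivative_X, derivative_C, dY_add, dY_mul,
      dY_X_pow, dY_X, dY_C, hd, derivative_one, derivative_add, add_zero, dY_C, C_add, C_1, dY_one]
    linear_combination 0 * two
  set W := K + (K * derivative K + C T * dY K) with hW
  have hWT : TD (2 ^ N - 1) W := by
    refine (hKT.mono (by omega)).add (TD.add ?_ ?_)
    · exact (hKT.mul (hKT.derivative (2 ^ (N - 1) - 1) (by omega))).mono (by omega)
    · exact ((TD.ofC hTd.le).mul (hKT.dY (2 ^ (N - 1) - 1) (by omega))).mono (by omega)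
  have hW2 : R * Dv K T H + H * (R * P) = C (T + 1) * W := by
    rw [← hprod, Dv_mul, hP]
  obtain ⟨hwT, hST⟩ := TD.divMod hRm hRd (Rp_TD B φ) hWT
  have hWdiv := modByMonic_add_div W R
  set S := W /ₘ R with hS
  set w := W %ₘ R with hw
  have hwdeg : w.degree < ((b : ℕ) : WithBot ℕ) := by
    rw [← hRD]; exact degree_modByMonic_lt _ hRm
  have hw0 : w = 0 := by
    have h1 : R ∣ C (T + 1) * w := by
      refine ⟨Dv K T H + H * P - C (T + 1) * S, ?_⟩
      linear_combination - hW2 + C (T + 1) * hWdiv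
    have h2 : (C (T + 1) * w).degree < ((b : ℕ) : WithBot ℕ) := by
      rw [degree_C_mul hT1ne]
      exact hwdeg
    have h3 := zero_of_monic_dvd hRm hRd h2 h1
    exact (mul_eq_zero.1 h3).resolve_left (C_ne_zero.2 hT1ne)
  rw [hw0, zero_add] at hWdiv
  have hST' : TD (n - 1) S := fun i j hij => hST i j (by omega)
  have hDH : Dv K T H + C (T + 1) * S = H * P := by
    have : R * (Dv K T H + C (T + 1) * S - H * P) = 0 := by
      linear_combination hW2 - C (T + 1) * hWdiv + (C (T + 1) * R * S - R * H * P) * two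
    exact sub_eq_zero.1 ((mul_eq_zero.1 this).resolve_left hRm.ne_zero)
  set Nn := dY H + S with hNn
  set Low := X * derivative H + C X * dY H + C (X + T + 1) * S with hLow
  have hNT : TD (n - 1) Nn := (hHT.dY _ (by omega)).add hST'
  have hH'T : TD (n - 1) (derivative H) := hHT.derivative _ (by omega)
  have hLT : TD (2 ^ (N - 1) + (n - 1)) Low := by
    refine TD.add (TD.add ?_ ?_) ?_
    · exact ((TD.ofX hpos).mul hH'T)
    · exact (TD.ofC (by rw [natDegree_X]; exact hpos)).mul (hHT.dY _ (by omega))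
    · refine (TD.ofC ?_).mul hST'
      rw [← C_1, natDegree_add_C]
      refine (natDegree_add_le _ _).trans (max_le (by rw [natDegree_X]; exact hpos) hTd.le)
  set E := X ^ (2 ^ N) * derivative H + C (X ^ (2 ^ N)) * Nn + Low with hE
  have hCX : TD (2 ^ N) (C (X ^ (2 ^ N)) : Polynomial (Polynomial F)) :=
    TD.ofC (by rw [natDegree_X_pow])
  have hET : TD (2 ^ N + (n - 1)) E :=
    (((TD.ofX_pow _).mul hH'T).add (hCX.mul hNT)).add (hLT.mono (by omega))
  have hHE : H ∣ E := by
    refine ⟨C (T + 1) * P - R * derivative H, ?_⟩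
    have hTC := congrArg (C : Polynomial F → Polynomial (Polynomial F)) hTsq
    simp only [C_add, C_pow, C_1] at hTC
    simp only [hE, hNn, hLow, Dv, C_add, C_1, C_pow] at *
    linear_combination (C T + 1) * hDH - (dY H + S) * hTC + derivative H * hRH +
      (X ^ 2 ^ N + X) * derivative H * two
  obtain ⟨-, hGT⟩ := TD.divMod hHm hHd hHT hET
  have hEdiv := modByMonic_add_div E H
  rw [(modByMonic_eq_zero_iff_dvd hHm).2 hHE, zero_add] at hEdiv
  set G := E /ₘ H with hG
  have hGT' : TD (2 ^ N - 1) G := fun i j hij => hGT i j (by omega)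
  refine ⟨hom (2 ^ N - 1) G, hom (n - 1) Nn, hom (2 ^ (N - 1) + (n - 1)) Low, hom_TD _ _ hNT, ?_⟩
  rw [← hom_mul hHT hGT', hEdiv, hE, (by omega : n + (2 ^ N - 1) = 2 ^ N + (n - 1)), hom_add,
    hom_add, hom_mul (TD.ofX_pow _) hH'T, hom_mul hCX hNT, hom_X, hom_derivative _ hn1]
  have e1 : hom (2 ^ N) (C (X ^ (2 ^ N)) : Polynomial (Polynomial F)) = 1 := by
    rw [hom_C]; simp
  have e2 : 2 ^ N + (n - 1) = 2 ^ (N - 1) + (n - 1) + 2 ^ (N - 1) := by omega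
  rw [e1, e2, hom_shift _ hLT, one_mul]
end Ext2

lemma exists_quot.{u} {R : Type u} [CommRing R] (J : Ideal R) :
    ∃ (A : Type u) (_ : CommRing A) (π : R →+* A), ∀ x, π x = 0 ↔ x ∈ J :=
  ⟨R ⧸ J, inferInstance, Ideal.Quotient.mk J, fun _ => Ideal.Quotient.eq_zero_iff_mem⟩

section Ext3
variable {F : Type*} [Field F] [CharP F 2] [Fintype F] [DecidableEq F]

lemma CX_dvd_of_map (p : Polynomial (Polynomial F)) (h : p.map (evalRingHom 0) = 0) :
    C X ∣ p := by
  rw [C_dvd_iff_dvd_coeff]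
  intro i
  rw [X_dvd_iff, coeff_zero_eq_eval_zero]
  have := congrArg (fun p => coeff p i) h
  simp only [coeff_map, coe_evalRingHom, coeff_zero] at this
  exact this

lemma L3 {N : ℕ} (hcard : Fintype.card F = 2 ^ N) (hN : 2 ≤ N)
    (E : Finset F) (Ht G M L : Polynomial (Polynomial F)) (hn1 : 1 ≤ E.card)
    (hsmall : E.card * (E.card - 1) < 2 ^ (N - 1))
    (hHm : Ht.Monic) (hHd : Ht.natDegree = E.card) (hHT : TD E.card Ht)
    (he : Ht.map (evalRingHom 0) = ∏ ε ∈ E, (X + C ε))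
    (hMT : TD (E.card - 1) M)
    (heq : Ht * G = X ^ (2 ^ N) * derivative Ht + M + C (X ^ (2 ^ (N - 1))) * L) :
    Ht ∣ ∏ ε ∈ E, (M + C (C ε) * derivative Ht) := by
  set n := E.card with hn
  set P := ∏ ε ∈ E, (M + C (C ε) * derivative Ht) with hP
  set m := 2 ^ (N - 1) with hm
  have two := two_PP (F := F)
  have hPT : TD (n * (n - 1)) P := TD.prod E (n - 1) _ fun ε _ =>
    hMT.add (((TD.ofC (k := 0) (by simp)).mul (hHT.derivative (n - 1) (by omega))).mono (by omega))
  have hmN : m ≤ 2 ^ N := Nat.pow_le_pow_right (by norm_num) (by omega)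
  -- membership in the ideal
  have hmem : P ∈ Ideal.span {Ht, C (X ^ m)} := by
    set J := Ideal.span {Ht, C (X ^ m)} with hJ
    obtain ⟨A, _, π, hπ⟩ := exists_quot J
    have hHJ : π Ht = 0 :=
      (hπ _).2 (Ideal.subset_span (by simp))
    have hXJ : π (C (X ^ m)) = 0 :=
      (hπ _).2 (Ideal.subset_span (by simp))
    set et : Polynomial (Polynomial F) := ∏ ε ∈ E, (X + C (C ε)) with het
    have h1 : C X ∣ et - Ht := by
      apply CX_dvd_of_map
      rw [Polynomial.map_sub, he, het, Polynomial.map_prod]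
      simp
    have h2 : π (et ^ (2 ^ N)) = 0 := by
      obtain ⟨u, hu⟩ := h1
      have h3 : et ^ (2 ^ N) = Ht ^ (2 ^ N) + C (X ^ m) * (C (X ^ (2 ^ N - m)) * u ^ (2 ^ N)) := by
        have : et = Ht + C X * u := by rw [← hu]; ring
        rw [this, add_pow_char_pow, mul_pow, ← mul_assoc, ← C_mul, ← pow_add,
          Nat.add_sub_cancel' hmN, C_pow]
      rw [h3, map_add, map_pow, map_mul, hHJ, hXJ, zero_mul, add_zero, zero_pow (by positivity)]
    rw [← hπ]
    have h4 : π P = π (et ^ (2 ^ N) * derivative Ht ^ n) := by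
      rw [hP, het, ← Finset.prod_pow, hn, ← Finset.prod_const, ← Finset.prod_mul_distrib,
        map_prod, map_prod]
      refine Finset.prod_congr rfl fun ε _ => ?_
      rw [← sub_eq_zero, ← map_sub]
      have h5 : M + C (C ε) * derivative Ht - (X + C (C ε)) ^ (2 ^ N) * derivative Ht =
          Ht * G - C (X ^ m) * L - X ^ (2 ^ N) * derivative Ht * 2 := by
        rw [add_pow_char_pow, ← C_pow, ← C_pow, frob hcard]
        linear_combination -heq
      rw [h5, two, mul_zero, sub_zero, map_sub, map_mul, map_mul, hHJ, hXJ]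
      simp
    rw [h4, map_mul, h2, zero_mul]
  obtain ⟨u, v, huv⟩ := Ideal.mem_span_pair.1 hmem
  rw [← modByMonic_eq_zero_iff_dvd hHm]
  have hrem : P %ₘ Ht = C (X ^ m) * (v %ₘ Ht) := by
    rw [← huv, add_modByMonic, (modByMonic_eq_zero_iff_dvd hHm).2 (dvd_mul_left _ _), zero_add,
      mul_comm v, ← smul_eq_C_mul, ← smul_eq_C_mul, smul_modByMonic]
  have hrT := (TD.divMod hHm hHd hHT hPT).1
  ext i j
  rw [coeff_zero, coeff_zero]
  by_cases hj : j < m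
  · rw [hrem, coeff_C_mul, coeff_X_pow_mul', if_neg (by omega)]
  · exact hrT i j (by omega)

lemma root_deg {n : ℕ} {Ht : Polynomial (Polynomial F)} (hHm : Ht.Monic) (hHd : Ht.natDegree = n)
    (hHT : TD n Ht) (hn : 1 ≤ n) (f : Polynomial F) (hf : Ht.eval f = 0) : f.natDegree ≤ 1 := by
  by_contra hd
  push Not at hd
  set d := f.natDegree with hdd
  have hf0 : f ≠ 0 := by
    intro h
    rw [hdd, h, natDegree_zero] at hd
    omega
  rw [eval_eq_sum_range, hHd, Finset.sum_range_succ] at hf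
  have hlc : Ht.coeff n = 1 := by rw [← hHd]; exact hHm
  rw [hlc, one_mul] at hf
  have h1 : (∑ i ∈ Finset.range n, Ht.coeff i * f ^ i).natDegree ≤ n * d - 1 := by
    apply natDegree_sum_le_of_forall_le
    intro i hi
    rw [Finset.mem_range] at hi
    refine (natDegree_mul_le).trans ?_
    have h2 := hHT.coeff_natDegree_le i
    rw [natDegree_pow, ← hdd]
    obtain ⟨k, rfl⟩ : ∃ k, n = i + k + 1 := ⟨n - i - 1, by omega⟩
    obtain ⟨e, he⟩ : ∃ e, d = e + 2 := ⟨d - 2, by omega⟩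
    rw [he]
    have : (Ht.coeff i).natDegree ≤ k + 1 := by omega
    have h5 : (i + k + 1) * (e + 2) = i * (e + 2) + (k + 1) * (e + 2) := by ring
    rw [h5]
    have : k + 1 + 1 ≤ (k + 1) * (e + 2) := by nlinarith
    omega
  have h3 : f ^ n = - (∑ i ∈ Finset.range n, Ht.coeff i * f ^ i) := by linear_combination hf
  have h4 := congrArg natDegree h3
  rw [natDegree_neg, natDegree_pow, ← hdd] at h4
  have : 0 < n * d := by positivity
  omega

lemma L4 {N : ℕ} (hcard : Fintype.card F = 2 ^ N) (hN : 2 ≤ N)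
    (E : Finset F) (Ht G M L : Polynomial (Polynomial F)) (hn1 : 1 ≤ E.card)
    (hsmall : E.card * (E.card - 1) < 2 ^ (N - 1))
    (hHm : Ht.Monic) (hHd : Ht.natDegree = E.card) (hHT : TD E.card Ht)
    (he : Ht.map (evalRingHom 0) = ∏ ε ∈ E, (X + C ε))
    (hMT : TD (E.card - 1) M)
    (heq : Ht * G = X ^ (2 ^ N) * derivative Ht + M + C (X ^ (2 ^ (N - 1))) * L) :
    ∃ ε ∈ E, ∃ a : F, (X + C (C a * X + C ε) : Polynomial (Polynomial F)) ∣ Ht := by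
  have h3 := L3 hcard hN E Ht G M L hn1 hsmall hHm hHd hHT he hMT heq
  have hnu : ¬ IsUnit Ht := by
    intro h
    have := natDegree_eq_zero_of_isUnit h
    omega
  obtain ⟨H0, hirr, hdvd⟩ := WfDvdMonoid.exists_irreducible_factor hnu hHm.ne_zero
  obtain ⟨Q, hQ⟩ := hdvd
  have hlead : H0.leadingCoeff * Q.leadingCoeff = 1 := by
    rw [← leadingCoeff_mul, ← hQ]; exact hHm
  have hu : IsUnit (C Q.leadingCoeff) := by
    refine IsUnit.map _ ?_
    exact IsUnit.of_mul_eq_one _ (by rw [mul_comm]; exact hlead)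
  set H1 := H0 * C Q.leadingCoeff with hH1
  have hass : Associated H0 H1 := ⟨hu.unit, by simp [hH1]⟩
  have hpr : Prime H1 := hass.prime (irreducible_iff_prime.1 hirr)
  have hH1m : H1.Monic := by
    rw [Monic, hH1, leadingCoeff_mul, leadingCoeff_C, hlead]
  have hH1d : H1 ∣ Ht := hass.dvd_iff_dvd_left.1 ⟨Q, hQ⟩
  obtain ⟨ε, hε, hεd⟩ := (hpr.dvd_finsetProd_iff _).1 (hH1d.trans h3)
  have hme := congrArg (Polynomial.map (evalRingHom 0)) heq
  simp only [Polynomial.map_add, Polynomial.map_mul, Polynomial.map_pow, map_X, map_C,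
    coe_evalRingHom, eval_pow, eval_X, ← derivative_map] at hme
  rw [zero_pow (by positivity), C_0, zero_mul, add_zero] at hme
  have h5 := Polynomial.map_dvd (evalRingHom (0 : F)) hεd
  simp only [Polynomial.map_add, Polynomial.map_mul, map_C,
    coe_evalRingHom, eval_C, ← derivative_map] at h5
  have h6 := Polynomial.map_dvd (evalRingHom (0 : F)) hH1d
  set e := Ht.map (evalRingHom (0 : F)) with hedef
  set e1 := H1.map (evalRingHom (0 : F)) with he1
  have hsep : e.Separable := by
    rw [he]
    simp only [← CharTwo.sub_eq_add]
    refine (separable_prod_X_sub_C_iff' (f := fun x : F => x)).2 ?_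
    intro x _ y _ h
    exact h
  have h7 : e1 ∣ (X + C ε) ^ (2 ^ N) * derivative e := by
    rw [add_pow_char_pow, ← C_pow, frob hcard]
    have : (X ^ (2 ^ N) + C ε) * derivative e =
      (Polynomial.map (evalRingHom 0) M + C ε * derivative e) + e * Polynomial.map (evalRingHom 0) G
        - 2 * Polynomial.map (evalRingHom 0) M := by
      linear_combination -hme
    rw [this, two_P, zero_mul, sub_zero]
    exact dvd_add h5 (h6.mul_right _)
  have hcop : IsCoprime e1 (derivative e) := hsep.of_isCoprime_of_dvd_left h6
  have h8 : e1 ∣ (X + C ε) ^ (2 ^ N) := hcop.dvd_of_dvd_mul_right h7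
  have h9 : e1 ∣ X + C ε :=
    ((hsep.squarefree.squarefree_of_dvd h6).dvd_pow_iff_dvd (by positivity)).1 h8
  have he1m : e1.Monic := hH1m.map _
  have hdeg1 : e1.natDegree = H1.natDegree := hH1m.natDegree_map _
  have hle : e1.natDegree ≤ 1 := by
    have := natDegree_le_of_dvd h9 (monic_X_add_C ε).ne_zero
    rwa [natDegree_X_add_C] at this
  have hne : H1.natDegree ≠ 0 := by
    intro h
    exact hpr.not_isUnit (by rw [(Polynomial.Monic.natDegree_eq_zero hH1m).1 h]; exact isUnit_one)
  have hd1 : H1.natDegree = 1 := by omega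
  have hXe : X + C ε = e1 := by
    apply eq_of_monic_of_dvd_of_natDegree_le he1m (monic_X_add_C ε) h9
    rw [natDegree_X_add_C]; omega
  have hH1f : H1 = X + C (H1.coeff 0) := hH1m.eq_X_add_C hd1
  set f := H1.coeff 0 with hf
  have hf0 : f.eval 0 = ε := by
    have : e1 = X + C (f.eval 0) := by rw [he1, hH1f]; simp
    rw [this] at hXe
    exact (C_injective (add_left_cancel hXe)).symm
  have hroot : Ht.eval f = 0 := by
    have : X - C f ∣ Ht := by rw [CharTwo.sub_eq_add, ← hH1f]; exact hH1d
    exact dvd_iff_isRoot.1 this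
  have hfd := root_deg hHm hHd hHT hn1 f hroot
  refine ⟨ε, hε, f.coeff 1, ?_⟩
  have : f = C (f.coeff 1) * X + C ε := by
    rw [← hf0, ← coeff_zero_eq_eval_zero]
    exact eq_X_add_C_of_natDegree_le_one hfd
  rw [← this, ← hH1f]
  exact hH1d

lemma hom_hom {n : ℕ} {H : Polynomial (Polynomial F)} (hT : TD n H) : hom n (hom n H) = H := by
  ext1 i
  rw [coeff_hom, coeff_hom]
  by_cases h : i ≤ n
  · rw [if_pos h, if_pos h, reflect_reflect]
  · rw [if_neg h]
    ext j
    rw [hT i j (by omega), coeff_zero]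

lemma L5 {n : ℕ} (hn : 1 ≤ n) {H : Polynomial (Polynomial F)} (hT : TD n H) (ε a : F)
    (h : (X + C (C a * X + C ε) : Polynomial (Polynomial F)) ∣ hom n H) :
    (X + C (C ε * X + C a) : Polynomial (Polynomial F)) ∣ H := by
  have hm : (X + C (C a * X + C ε) : Polynomial (Polynomial F)).Monic := monic_X_add_C _
  have hd := TD.divMod hm (natDegree_X_add_C _) (TD_line a ε) (hom_TD n H hT)
  have h1 := modByMonic_add_div (hom n H) (X + C (C a * X + C ε))
  rw [(modByMonic_eq_zero_iff_dvd hm).2 h, zero_add] at h1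
  have h2 : TD (n - 1) (hom n H /ₘ (X + C (C a * X + C ε))) := fun i j hij => hd.2 i j (by omega)
  have h3 := hom_mul (TD_line a ε) h2
  rw [h1, Nat.add_sub_cancel' hn, hom_hom hT, hom_line] at h3
  exact ⟨_, h3⟩

lemma L6 {N : ℕ} (hcard : Fintype.card F = 2 ^ N) (hN : 2 ≤ N)
    (B : Finset F) (φ : F → F) (hB : ∀ x ∈ B, ∀ y ∈ B, x ≠ y → tr N ((φ x + φ y) / (x + y)) = 0)
    (hB2 : 2 ≤ B.card) (hn1 : 1 ≤ Bᶜ.card) (hsmall : Bᶜ.card * (Bᶜ.card - 1) < 2 ^ (N - 1)) :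
    ∃ ε ∈ Bᶜ, ∃ a : F, ∀ y ∈ B, tr N ((φ y + a) / (y + ε)) = 0 := by
  obtain ⟨H, K, hRH, hHm, hHd, hHT, hKT, he⟩ := L1 hcard hN B φ hB hB2
  obtain ⟨G, M, L, hMT, heq⟩ := L2 hcard hN B φ hn1 H K hRH hHm hHd hHT hKT
  have hHtT := hom_TD _ _ hHT
  have hcn : (hom Bᶜ.card H).coeff Bᶜ.card = 1 := by
    rw [coeff_hom, if_pos le_rfl]
    have : H.coeff Bᶜ.card = 1 := by rw [← hHd]; exact hHm
    rw [this]; simp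
  have hHtm : (hom Bᶜ.card H).Monic := monic_of_natDegree_le_of_coeff_eq_one _ hHtT.natDegree_le hcn
  have hHtd : (hom Bᶜ.card H).natDegree = Bᶜ.card :=
    le_antisymm hHtT.natDegree_le (le_natDegree_of_ne_zero (by rw [hcn]; exact one_ne_zero))
  obtain ⟨ε, hε, a, hdiv⟩ := L4 hcard hN Bᶜ _ G M L hn1 hsmall hHtm hHtd hHtT he hMT heq
  refine ⟨ε, hε, a, fun y hy => ?_⟩
  obtain ⟨Q, hQ⟩ := L5 hn1 hHT ε a hdiv
  have hne : y + ε ≠ 0 := by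
    rw [← CharTwo.sub_eq_add]
    refine sub_ne_zero.2 ?_
    rintro rfl
    exact (Finset.mem_compl.1 hε) hy
  rcases tr_zero_or_one hcard ((φ y + a) / (y + ε)) with h | h
  · exact h
  exfalso
  set d := (φ y + a) / (y + ε) with hd
  have hd' : d * (y + ε) = φ y + a := by rw [hd]; field_simp
  have h1 := congrArg (Polynomial.map (evalRingHom d)) hRH
  have hRy : Rp B φ = (X + C (C y * X + C (φ y))) * ∏ z ∈ B.erase y, (X + C (C z * X + C (φ z))) :=
    (Finset.mul_prod_erase B _ hy).symm
  rw [hRy, hQ] at h1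
  simp only [Polynomial.map_add, Polynomial.map_mul, Polynomial.map_pow, map_X, map_C,
    coe_evalRingHom, eval_add, eval_mul, eval_C, eval_X, eval_one, Tp_eval, h,
    CharTwo.add_self_eq_zero, C_0, zero_mul, add_zero] at h1
  have h2 := congrArg (fun p => eval (y * d + φ y) (derivative p)) h1
  have hz : ((2 ^ N : ℕ) : F) = 0 := by
    push_cast
    rw [CharTwo.two_eq_zero, zero_pow (by omega)]
  have hs : y * d + φ y + (ε * d + a) = 0 := by
    linear_combination hd' + (φ y + a) * (CharTwo.two_eq_zero : (2 : F) = 0)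
  simp only [derivative_mul, derivative_add, derivative_X, derivative_X_pow, eval_add, eval_mul,
    eval_X, eval_C, hz, C_0, zero_mul, eval_zero, eval_one, hs, CharTwo.add_self_eq_zero] at h2
  simp at h2
end Ext3

section Full
variable {F : Type*} [Field F] [CharP F 2] [Fintype F] [DecidableEq F]

lemma add_ne_zero_of_ne {x y : F} (h : x ≠ y) : x + y ≠ 0 := by
  rw [← CharTwo.sub_eq_add]; exact sub_ne_zero.2 h

lemma extend {N : ℕ} (hcard : Fintype.card F = 2 ^ N) (hN : 2 ≤ N) (n : ℕ) :
    ∀ (B : Finset F) (φ : F → F), Bᶜ.card = n →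
    (∀ x ∈ B, ∀ y ∈ B, x ≠ y → tr N ((φ x + φ y) / (x + y)) = 0) →
    2 ≤ B.card → n * (n - 1) < 2 ^ (N - 1) →
    ∃ ψ : F → F, (∀ y ∈ B, ψ y = φ y) ∧ ∀ x y, x ≠ y → tr N ((ψ x + ψ y) / (x + y)) = 0 := by
  induction n with
  | zero =>
    intro B φ h0 hB _ _
    have hu : ∀ x, x ∈ B := by
      intro x
      by_contra hx
      have := Finset.card_pos.2 ⟨x, Finset.mem_compl.2 hx⟩
      omega
    exact ⟨φ, fun _ _ => rfl, fun x y => hB x (hu x) y (hu y)⟩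
  | succ n ih =>
    intro B φ hc hB hB2 hs
    obtain ⟨ε, hε, a, ha⟩ := L6 hcard hN B φ hB hB2 (by omega) (by rw [hc]; exact hs)
    have hε' : ε ∉ B := Finset.mem_compl.1 hε
    have hup : ∀ y ∈ B, Function.update φ ε a y = φ y := by
      intro y hy
      rw [Function.update_of_ne]
      rintro rfl
      exact hε' hy
    obtain ⟨ψ, h1, h2⟩ := ih (insert ε B) (Function.update φ ε a)
      (by
        have h1 := Finset.card_add_card_compl B
        have h2 := Finset.card_add_card_compl (insert ε B)
        rw [Finset.card_insert_of_notMem hε'] at h2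
        omega)
      (by
        intro x hx y hy hxy
        rcases Finset.mem_insert.1 hx with rfl | hx'
        · rcases Finset.mem_insert.1 hy with rfl | hy
          · exact absurd rfl hxy
          · rw [hup y hy, Function.update_self, add_comm a, add_comm x]
            exact ha y hy
        · rcases Finset.mem_insert.1 hy with rfl | hy
          · rw [hup x hx', Function.update_self]
            exact ha x hx'
          · rw [hup x hx', hup y hy]
            exact hB x hx' y hy hxy)
      (by rw [Finset.card_insert_of_notMem hε']; omega)
      (lt_of_le_of_lt (Nat.mul_le_mul (by omega) (by omega)) hs)
    refine ⟨ψ, fun y hy => ?_, h2⟩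
    rw [h1 y (Finset.mem_insert_of_mem hy), hup y hy]

lemma mu_card {N : ℕ} (hcard : Fintype.card F = 2 ^ N) (k : ℕ) (hk1 : 1 ≤ k)
    (hk2 : k + 1 < 2 ^ N) :
    2 * (Finset.univ.filter fun z : F => z ≠ 0 ∧ z ^ k = 1).card < 2 ^ N := by
  set S := Finset.univ.filter fun z : F => z ≠ 0 ∧ z ^ k = 1 with hS
  have hex : ∃ z0 : F, z0 ≠ 0 ∧ z0 ^ k ≠ 1 := by
    by_contra hcon
    push Not at hcon
    have h1 : (Finset.univ.erase (0 : F)).card ≤ (X ^ k - 1 : Polynomial F).natDegree := by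
      apply Polynomial.card_le_degree_of_subset_roots
      intro z hz
      rw [Finset.mem_val, Finset.mem_erase] at hz
      rw [← C_1, mem_roots (X_pow_sub_C_ne_zero hk1 (1 : F))]
      simp [hcon z hz.1]
    rw [Finset.card_erase_of_mem (Finset.mem_univ _), Finset.card_univ, hcard, ← C_1,
      natDegree_X_pow_sub_C] at h1
    omega
  obtain ⟨z0, hz0, hz1⟩ := hex
  have hinj : Function.Injective fun z => z0 * z := mul_right_injective₀ hz0
  have hdisj : Disjoint S (S.image fun z => z0 * z) := by
    rw [Finset.disjoint_left]
    intro z hz hz'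
    obtain ⟨w, hw, rfl⟩ := Finset.mem_image.1 hz'
    simp only [hS, Finset.mem_filter, Finset.mem_univ, true_and] at hz hw
    rw [mul_pow, hw.2, mul_one] at hz
    exact hz1 hz.2
  have h2 : (S ∪ S.image fun z => z0 * z) ⊆ Finset.univ.erase 0 := by
    intro z hz
    rw [Finset.mem_erase]
    refine ⟨?_, Finset.mem_univ _⟩
    rcases Finset.mem_union.1 hz with hz | hz
    · simp only [hS, Finset.mem_filter, Finset.mem_univ, true_and] at hz
      exact hz.1
    · obtain ⟨w, hw, rfl⟩ := Finset.mem_image.1 hz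
      simp only [hS, Finset.mem_filter, Finset.mem_univ, true_and] at hw
      exact mul_ne_zero hz0 hw.1
  have h3 := Finset.card_le_card h2
  rw [Finset.card_union_of_disjoint hdisj, Finset.card_image_of_injective _ hinj,
    Finset.card_erase_of_mem (Finset.mem_univ _), Finset.card_univ, hcard] at h3
  omega

lemma moment {N : ℕ} (hcard : Fintype.card F = 2 ^ N) (hN : 2 ≤ N) (ψ : F → F)
    (h1 : ∀ x, x ≠ 0 → tr N (ψ x) = 0)
    (h2 : ∀ x z, x ≠ 0 → z ≠ 0 → z ≠ 1 → tr N ((ψ x + z * ψ (x * z)) / (1 + z)) = 0)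
    (k : ℕ) (hk1 : 1 ≤ k) (hk2 : k + 1 < 2 ^ N) : ∑ x : F, x ^ k * ψ x = 0 := by
  set M : ℕ → F := fun j => ∑ x : F, x ^ k * ψ x ^ (2 ^ j) with hM
  have hsum : ∑ j ∈ Finset.range N, M j = 0 := by
    simp only [hM]
    rw [Finset.sum_comm]
    refine Finset.sum_eq_zero fun x _ => ?_
    rw [← Finset.mul_sum]
    by_cases hx : x = 0
    · rw [hx, zero_pow (by omega), zero_mul]
    · have := h1 x hx
      rw [tr] at this
      rw [this, mul_zero]
  have hz : ∀ z : F, z ≠ 0 → z ≠ 1 → z ^ k ≠ 1 →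
      ∑ j ∈ Finset.range N, M j * (1 / (1 + z)) ^ (2 ^ j) = 0 := by
    intro z hz0 hz1 hzk
    have hz1' : 1 + z ≠ 0 := add_ne_zero_of_ne hz1.symm
    have hshift : ∀ j, z ^ k * ∑ x : F, x ^ k * ψ (x * z) ^ (2 ^ j) = M j := by
      intro j
      simp only [hM]
      rw [← Equiv.sum_comp (Equiv.mulRight₀ z hz0) (fun x => x ^ k * ψ x ^ (2 ^ j)),
        Finset.mul_sum]
      refine Finset.sum_congr rfl fun x _ => ?_
      simp [mul_pow]; ring
    have h3 : ∑ x : F, x ^ k * tr N ((ψ x + z * ψ (x * z)) / (1 + z)) = 0 := by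
      refine Finset.sum_eq_zero fun x _ => ?_
      by_cases hx : x = 0
      · rw [hx, zero_pow (by omega), zero_mul]
      · rw [h2 x z hx hz0 hz1, mul_zero]
    simp only [tr, Finset.mul_sum] at h3
    rw [Finset.sum_comm] at h3
    have h4 : ∀ j ∈ Finset.range N,
        z ^ k * ∑ x : F, x ^ k * ((ψ x + z * ψ (x * z)) / (1 + z)) ^ (2 ^ j) =
        (1 + z ^ k) * (M j * (1 / (1 + z)) ^ (2 ^ j)) + M j := by
      intro j _
      have h5 : ∑ x : F, x ^ k * ((ψ x + z * ψ (x * z)) / (1 + z)) ^ (2 ^ j) =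
          (1 / (1 + z)) ^ (2 ^ j) * (M j + z ^ (2 ^ j) * ∑ x : F, x ^ k * ψ (x * z) ^ (2 ^ j)) := by
        simp only [hM]
        rw [Finset.mul_sum, ← Finset.sum_add_distrib, Finset.mul_sum]
        refine Finset.sum_congr rfl fun x _ => ?_
        rw [div_eq_mul_one_div, mul_pow, add_pow_char_pow, mul_pow]
        ring
      have h6 : (1 / (1 + z)) ^ (2 ^ j) * z ^ (2 ^ j) = 1 + (1 / (1 + z)) ^ (2 ^ j) := by
        have : 1 / (1 + z) * z = 1 + 1 / (1 + z) := by
          field_simp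
          linear_combination -(CharTwo.two_eq_zero : (2 : F) = 0)
        rw [← mul_pow, this, add_pow_char_pow, one_pow]
      rw [h5]
      linear_combination (1 / (1 + z)) ^ (2 ^ j) * z ^ (2 ^ j) * hshift j + M j * h6
    have h7 := congrArg (fun t => z ^ k * t) h3
    simp only [mul_zero] at h7
    rw [Finset.mul_sum, Finset.sum_congr rfl h4, Finset.sum_add_distrib, hsum, add_zero,
      ← Finset.mul_sum] at h7
    exact (mul_eq_zero.1 h7).resolve_left (add_ne_zero_of_ne (Ne.symm hzk))
  set P : Polynomial F := ∑ j ∈ Finset.range N, C (M j) * X ^ (2 ^ j) with hP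
  have hPe : ∀ v, P.eval v = ∑ j ∈ Finset.range N, M j * v ^ (2 ^ j) := by
    intro v; simp [hP, eval_finsetSum]
  have hPd : P.natDegree ≤ 2 ^ (N - 1) := by
    apply natDegree_sum_le_of_forall_le
    intro j hj
    rw [Finset.mem_range] at hj
    exact (natDegree_C_mul_X_pow_le _ _).trans (Nat.pow_le_pow_right (by norm_num) (by omega))
  have hP0 : P = 0 := by
    by_contra hne
    set V := Finset.univ.filter fun v : F => P.eval v = 0 with hV
    set S := Finset.univ.filter fun z : F => z ≠ 0 ∧ z ^ k = 1 with hS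
    have hc1 : V.card ≤ P.natDegree := by
      apply Polynomial.card_le_degree_of_subset_roots
      intro v hv
      rw [Finset.mem_val, hV, Finset.mem_filter] at hv
      rw [mem_roots hne]
      exact hv.2
    have hsub : Vᶜ ⊆ S.image fun z => 1 / (1 + z) := by
      intro v hv
      rw [Finset.mem_compl, hV, Finset.mem_filter] at hv
      push Not at hv
      have hv := hv (Finset.mem_univ _)
      have hv0 : v ≠ 0 := by
        rintro rfl
        apply hv
        rw [hPe]
        simp
      have hv1 : v ≠ 1 := by
        rintro rfl
        apply hv
        rw [hPe]
        simpa using hsum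
      have hvv : 1 / (1 + (1 + 1 / v)) = v := by
        rw [← add_assoc, CharTwo.add_self_eq_zero, zero_add, one_div_one_div]
      have hz0 : 1 + 1 / v ≠ 0 := by
        apply add_ne_zero_of_ne
        intro h
        apply hv1
        field_simp at h
        exact h
      refine Finset.mem_image.2 ⟨1 + 1 / v, ?_, hvv⟩
      rw [hS, Finset.mem_filter]
      refine ⟨Finset.mem_univ _, hz0, ?_⟩
      by_contra hk
      apply hv
      rw [hPe]
      have := hz (1 + 1 / v) hz0 (by simpa using hv0) hk
      rwa [hvv] at this
    have hc2 := (Finset.card_le_card hsub).trans Finset.card_image_le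
    have hc3 := mu_card hcard k hk1 hk2
    have hc4 := Finset.card_add_card_compl V
    rw [hcard] at hc4
    have hpow : 2 ^ N = 2 ^ (N - 1) + 2 ^ (N - 1) := by
      obtain ⟨M, rfl⟩ : ∃ M, N = M + 1 := ⟨N - 1, by omega⟩
      simp [pow_succ]; ring
    rw [← hS] at hc3
    omega
  have hco : P.coeff 1 = M 0 := by
    rw [hP, finsetSum_coeff, Finset.sum_eq_single 0]
    · simp
    · intro j _ hj
      rw [coeff_C_mul_X_pow, if_neg]
      intro h
      exact hj (by simpa using h.symm)
    · intro h
      exact absurd (Finset.mem_range.2 (by omega)) h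
  rw [hP0, coeff_zero] at hco
  simpa [hM] using hco.symm

lemma full {N : ℕ} (hcard : Fintype.card F = 2 ^ N) (hN : 2 ≤ N) (φ : F → F)
    (h : ∀ x y, x ≠ y → tr N ((φ x + φ y) / (x + y)) = 0) :
    ∃ u v : F, ∀ x, φ x = u + x * v := by
  set ψ : F → F := fun x => (φ x + φ 0) / x with hψ
  have hψ0 : ψ 0 = 0 := by simp [hψ]
  have h1 : ∀ x, x ≠ 0 → tr N (ψ x) = 0 := by
    intro x hx
    have := h x 0 hx
    rwa [add_zero] at this
  have h2 : ∀ x z, x ≠ 0 → z ≠ 0 → z ≠ 1 → tr N ((ψ x + z * ψ (x * z)) / (1 + z)) = 0 := by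
    intro x z hx hz0 hz1
    have hz1' : 1 + z ≠ 0 := add_ne_zero_of_ne hz1.symm
    have hne : x ≠ x * z := by
      intro hh
      apply hz1
      have : x * z = x * 1 := by rw [← hh, mul_one]
      exact mul_left_cancel₀ hx this
    have := h x (x * z) hne
    have e : (ψ x + z * ψ (x * z)) / (1 + z) = (φ x + φ (x * z)) / (x + x * z) := by
      simp only [hψ]
      have : x + x * z ≠ 0 := add_ne_zero_of_ne hne
      field_simp
      linear_combination (φ 0) * (CharTwo.two_eq_zero : (2 : F) = 0)
    rw [e]; exact this
  have hm := fun k hk1 hk2 => moment hcard hN ψ h1 h2 k hk1 hk2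
  have hq : 4 ≤ 2 ^ N := by
    calc 4 = 2 ^ 2 := by norm_num
      _ ≤ 2 ^ N := Nat.pow_le_pow_right (by norm_num) hN
  have hconst : ∀ w, w ≠ 0 → ψ w = ∑ x, ψ x := by
    intro w hw
    have e1 : ∑ k ∈ Finset.range (2 ^ N - 1), ∑ x, (x / w) ^ k * ψ x = ∑ x, ψ x := by
      rw [Finset.sum_eq_single 0]
      · simp
      · intro k hk hk0
        rw [Finset.mem_range] at hk
        have := hm k (by omega) (by omega)
        have e : ∀ x, (x / w) ^ k * ψ x = (1 / w) ^ k * (x ^ k * ψ x) := by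
          intro x
          rw [div_eq_mul_one_div, mul_pow]; ring
        simp only [e]
        rw [← Finset.mul_sum, this, mul_zero]
      · intro h0
        exact absurd (Finset.mem_range.2 (by omega)) h0
    rw [← e1, Finset.sum_comm, Finset.sum_eq_single w]
    · rw [← Finset.sum_mul, div_self hw]
      simp only [one_pow, Finset.sum_const, Finset.card_range, nsmul_eq_mul, mul_one]
      have : ((2 ^ N - 1 : ℕ) : F) = 1 := by
        rw [Nat.cast_sub (by omega)]
        push_cast
        rw [CharTwo.two_eq_zero, zero_pow (by omega)]
        linear_combination -(CharTwo.two_eq_zero : (2 : F) = 0)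
      rw [this, one_mul]
    · intro x _ hxw
      rw [← Finset.sum_mul]
      by_cases hx : x = 0
      · rw [hx, hψ0, mul_zero]
      · have hr : x / w ≠ 1 := by
          intro hh
          rw [div_eq_one_iff_eq hw] at hh
          exact hxw hh
        have hg := geom_sum_mul (x / w) (2 ^ N - 1)
        rw [← hcard, FiniteField.pow_card_sub_one_eq_one _ (div_ne_zero hx hw), sub_self] at hg
        rw [← hcard, (mul_eq_zero.1 hg).resolve_right (sub_ne_zero.2 hr), zero_mul]
    · intro hh
      exact absurd (Finset.mem_univ _) hh
  refine ⟨φ 0, ∑ x, ψ x, fun x => ?_⟩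
  by_cases hx : x = 0
  · rw [hx]; simp
  · rw [← hconst x hx]
    simp only [hψ]
    field_simp
    linear_combination -(φ 0) * (CharTwo.two_eq_zero : (2 : F) = 0)

lemma affine {N : ℕ} (hcard : Fintype.card F = 2 ^ N) (hN : 2 ≤ N) (B : Finset F) (φ : F → F)
    (hB : ∀ x ∈ B, ∀ y ∈ B, x ≠ y → tr N ((φ x + φ y) / (x + y)) = 0)
    (hB2 : 2 ≤ B.card) (hs : Bᶜ.card * (Bᶜ.card - 1) < 2 ^ (N - 1)) :
    ∃ u v : F, ∀ x ∈ B, φ x = u + x * v := by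
  obtain ⟨ψ, h1, h2⟩ := extend hcard hN _ B φ rfl hB hB2 hs
  obtain ⟨u, v, h⟩ := full hcard hN ψ h2
  exact ⟨u, v, fun x hx => by rw [← h1 x hx, h]⟩
end Full

section Assembly
variable {F : Type*} [Field F] [CharP F 2] [Fintype F] [DecidableEq F]

lemma quad_trace {N : ℕ} (hcard : Fintype.card F = 2 ^ N) (A b τ x : F) (hb : b ≠ 0)
    (h : A + b * x + (b + τ) * x ^ 2 = 0) : tr N (A * (b + τ) / b ^ 2) = 0 := by
  have e : A * (b + τ) / b ^ 2 = (b + τ) * x / b + ((b + τ) * x / b) ^ 2 := by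
    field_simp
    linear_combination (b + τ) * h - (b + τ) * (b * x + (b + τ) * x ^ 2) *
      (CharTwo.two_eq_zero : (2 : F) = 0)
  rw [e]
  exact tr_artin hcard _

lemma single {N : ℕ} (hcard : Fintype.card F = 2 ^ N) (hN : 2 ≤ N) (B : Finset F) (φ : F → F)
    (t : F) (hn : 4 * Bᶜ.card ^ 2 ≤ 2 ^ N)
    (hint : ∀ b ∈ B, ∀ b' ∈ B, ∃ x : F,
      φ b + b * x + (b + t) * x ^ 2 = φ b' + b' * x + (b' + t) * x ^ 2) :
    ∃ u v s : F, v = s + s ^ 2 ∧ ∀ b ∈ B, φ b = u + b * v := by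
  have hq : 4 ≤ 2 ^ N := by
    calc 4 = 2 ^ 2 := by norm_num
      _ ≤ 2 ^ N := Nat.pow_le_pow_right (by norm_num) hN
  have hpow : 2 ^ N = 2 ^ (N - 1) + 2 ^ (N - 1) := by
    obtain ⟨M, rfl⟩ : ∃ M, N = M + 1 := ⟨N - 1, by omega⟩
    simp [pow_succ]; ring
  have hbn : B.card + Bᶜ.card = 2 ^ N := by rw [← hcard]; exact Finset.card_add_card_compl B
  have hsq : Bᶜ.card ≤ Bᶜ.card ^ 2 := Nat.le_self_pow (by norm_num) _
  have hB2 : 2 ≤ B.card := by omega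
  have hs : Bᶜ.card * (Bᶜ.card - 1) < 2 ^ (N - 1) := by
    have : Bᶜ.card * (Bᶜ.card - 1) ≤ Bᶜ.card ^ 2 := by
      rw [pow_two]; exact Nat.mul_le_mul le_rfl (by omega)
    omega
  have key : ∀ b ∈ B, ∀ b' ∈ B, ∃ x : F, φ b + φ b' = (b + b') * (x + x ^ 2) := by
    intro b hb b' hb'
    obtain ⟨x, hx⟩ := hint b hb b' hb'
    refine ⟨x, ?_⟩
    linear_combination hx + (φ b' - b * (x + x ^ 2)) * (CharTwo.two_eq_zero : (2 : F) = 0)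
  obtain ⟨u, v, huv⟩ := affine hcard hN B φ (by
    intro x hx y hy hxy
    obtain ⟨z, hz⟩ := key x hx y hy
    rw [hz, mul_div_cancel_left₀ _ (add_ne_zero_of_ne hxy)]
    exact tr_artin hcard z) hB2 hs
  obtain ⟨b, hb, b', hb', hne⟩ := Finset.one_lt_card.1 (by omega : 1 < B.card)
  obtain ⟨x, hx⟩ := key b hb b' hb'
  refine ⟨u, v, x, ?_, huv⟩
  rw [huv b hb, huv b' hb'] at hx
  apply mul_left_cancel₀ (add_ne_zero_of_ne hne)
  linear_combination hx - u * (CharTwo.two_eq_zero : (2 : F) = 0)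

/-- two sets with small complements: many solutions of `b + b' = c` -/
lemma many {N : ℕ} (hcard : Fintype.card F = 2 ^ N) (B B' : Finset F) (c : F) :
    2 ^ N ≤ (B.filter fun b => b + c ∈ B').card + Bᶜ.card + B'ᶜ.card := by
  have h1 : (Finset.univ : Finset F) ⊆
      (B.filter fun b => b + c ∈ B') ∪ Bᶜ ∪ B'ᶜ.image (fun b => b + c) := by
    intro b _
    by_cases hb : b ∈ B
    · by_cases hb' : b + c ∈ B'
      · simp [hb, hb']
      · refine Finset.mem_union_right _ (Finset.mem_image.2 ⟨b + c, Finset.mem_compl.2 hb', ?_⟩)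
        rw [add_assoc, CharTwo.add_self_eq_zero, add_zero]
    · simp [hb]
  have h2 := Finset.card_le_card h1
  rw [Finset.card_univ, hcard] at h2
  refine h2.trans ((Finset.card_union_le _ _).trans ?_)
  exact add_le_add (Finset.card_union_le _ _) Finset.card_image_le

/-- the field with four elements -/
lemma q_four (hcard : Fintype.card F = 2 ^ 2) (B B' : Finset F) (τ u u' : F) (hτ : τ ≠ 0)
    (hn : 4 * Bᶜ.card ^ 2 ≤ 2 ^ 2) (hn' : 4 * B'ᶜ.card ^ 2 ≤ 2 ^ 2)
    (hint : ∀ b ∈ B, ∀ b' ∈ B', b + b' ≠ 0 →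
      tr 2 ((u + u' + b') * (b + b' + τ) / (b + b') ^ 2) = 0) : False := by
  have two : (2 : F) = 0 := CharTwo.two_eq_zero
  have h1 : Bᶜ.card ≤ 1 := by nlinarith
  have h1' : B'ᶜ.card ≤ 1 := by nlinarith
  set c := u + u' with hc
  have hcne : c ≠ c + τ := by simpa using hτ
  have hb : ∃ b ∈ B, b = c ∨ b = c + τ := by
    by_contra hcon
    push Not at hcon
    have e1 : c ∈ Bᶜ := Finset.mem_compl.2 fun h => (hcon c h).1 rfl
    have e2 : c + τ ∈ Bᶜ := Finset.mem_compl.2 fun h => (hcon _ h).2 rfl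
    exact hcne (Finset.card_le_one.1 h1 _ e1 _ e2)
  have hb' : ∃ b' ∈ B', b' ≠ c ∧ b' ≠ c + τ := by
    by_contra hcon
    push Not at hcon
    have : B' ⊆ {c, c + τ} := by
      intro x hx
      by_cases hxc : x = c
      · simp [hxc]
      · simp [hcon x hx hxc]
    have e1 := (Finset.card_le_card this).trans Finset.card_le_two
    have e2 := Finset.card_add_card_compl B'
    rw [hcard] at e2
    omega
  obtain ⟨b, hbB, hbc⟩ := hb
  obtain ⟨b', hbB', hb1, hb2⟩ := hb'
  have hbb : b ≠ b' := by
    rintro rfl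
    rcases hbc with h | h
    · exact hb1 h
    · exact hb2 h
  have hne : b + b' ≠ 0 := add_ne_zero_of_ne hbb
  have hneτ : b + b' ≠ τ := by
    intro h
    rcases hbc with h' | h'
    · apply hb2
      rw [← h, h']; linear_combination -c * two
    · apply hb1
      rw [h'] at h
      linear_combination h - c * two
  have h0 := hint b hbB b' hbB' hne
  set d := b + b' with hd
  set w := τ / d with hw
  have hwd : τ = w * d := by rw [hw]; field_simp
  have hw0 : w ≠ 0 := div_ne_zero hτ hne
  have hw1 : w ≠ 1 := by
    intro h
    rw [h, one_mul] at hwd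
    exact hneτ hwd.symm
  have hw4 : w ^ 4 = w := by
    have := FiniteField.pow_card w
    rwa [hcard] at this
  have hw2 : w ^ 2 + w + 1 = 0 := by
    have : w * ((w - 1) * (w ^ 2 + w + 1)) = 0 := by linear_combination hw4
    exact ((mul_eq_zero.1 ((mul_eq_zero.1 this).resolve_left hw0)).resolve_left
      (sub_ne_zero.2 hw1))
  have htr : ∀ y : F, tr 2 y = y + y ^ 2 := by
    intro y; simp [tr, Finset.sum_range_succ]
  rcases hbc with h | h
  · have e : (c + b') * (d + τ) / d ^ 2 = 1 + w := by
      rw [← h, ← hd, hwd]; field_simp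
    rw [e, htr] at h0
    have : (1 : F) = 0 := by linear_combination hw2 - h0 + (1 + w) * two
    exact one_ne_zero this
  · have hA : c + b' = d + τ := by rw [hd, h]; linear_combination -τ * two
    have e : (c + b') * (d + τ) / d ^ 2 = (1 + w) ^ 2 := by
      rw [hA, hwd]; field_simp
    rw [e, htr] at h0
    have : (1 : F) = 0 := by
      linear_combination h0 + (-w ^ 2 - 3 * w - 3) * hw2 + two
    exact one_ne_zero this

lemma v_eq {N : ℕ} (hcard : Fintype.card F = 2 ^ N) (hN : 2 ≤ N) (B B' : Finset F)
    (τ u u' v v' s s' : F) (hτ : τ ≠ 0) (hvs : v = s + s ^ 2) (hvs' : v' = s' + s' ^ 2)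
    (hn : 4 * Bᶜ.card ^ 2 ≤ 2 ^ N) (hn' : 4 * B'ᶜ.card ^ 2 ≤ 2 ^ N)
    (hint : ∀ b ∈ B, ∀ b' ∈ B', b + b' ≠ 0 →
      tr N ((u + b * v + (u' + b' * v')) * (b + b' + τ) / (b + b') ^ 2) = 0) : v = v' := by
  have two : (2 : F) = 0 := CharTwo.two_eq_zero
  by_cases hN3 : N = 2
  · subst hN3
    have hv : ∀ v s : F, v = s + s ^ 2 → v = 0 ∨ v = 1 := by
      intro v s h
      have h4 : s ^ 4 = s := by
        have := FiniteField.pow_card s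
        rwa [hcard] at this
      have : v * (v - 1) = 0 := by
        rw [h]; linear_combination h4 + s ^ 3 * two
      rcases mul_eq_zero.1 this with h | h
      · exact Or.inl h
      · exact Or.inr (sub_eq_zero.1 h)
    rcases hv v s hvs with h | h <;> rcases hv v' s' hvs' with h' | h'
    · rw [h, h']
    · exfalso
      refine q_four hcard B B' τ u u' hτ hn hn' fun b hb b' hb' hne => ?_
      have := hint b hb b' hb' hne
      rw [h, h', mul_zero, mul_one, add_zero, ← add_assoc] at this
      exact this
    · exfalso
      refine q_four hcard B' B τ u' u hτ hn' hn fun b' hb' b hb hne => ?_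
      have := hint b hb b' hb' (by rwa [add_comm])
      rw [h, h', mul_zero, mul_one, add_zero] at this
      rw [add_comm b' b, (by ring : u' + u + b = u + b + u')]
      exact this
    · rw [h, h']
  · have hN3 : 3 ≤ N := by omega
    have hpow : 2 ^ N = 2 ^ (N - 1) + 2 ^ (N - 1) := by
      obtain ⟨M, rfl⟩ : ∃ M, N = M + 1 := ⟨N - 1, by omega⟩
      simp [pow_succ]; ring
    have hq : 8 ≤ 2 ^ N := by
      calc 8 = 2 ^ 3 := by norm_num
        _ ≤ 2 ^ N := Nat.pow_le_pow_right (by norm_num) hN3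
    obtain ⟨c, hc⟩ : ∃ c : F, c ∉ ({0, τ} : Finset F) := by
      by_contra hcon
      push Not at hcon
      have := (Finset.card_le_card (fun x _ => hcon x :
        (Finset.univ : Finset F) ⊆ {0, τ})).trans Finset.card_le_two
      rw [Finset.card_univ, hcard] at this
      omega
    simp only [Finset.mem_insert, Finset.mem_singleton, not_or] at hc
    have hm := many hcard B B' c
    set S := B.filter fun b => b + c ∈ B' with hS
    have hsum : Bᶜ.card + B'ᶜ.card < 2 ^ (N - 1) := by
      have h1 : (Bᶜ.card + B'ᶜ.card) ^ 2 ≤ 2 ^ N := by nlinarith [sq_nonneg ((Bᶜ.card : ℤ) - B'ᶜ.card)]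
      by_contra hcon
      push Not at hcon
      nlinarith
    have h0 := tr_count hcard (by omega) ((v + v') * (c + τ) / c ^ 2)
      ((u + u' + c * v') * (c + τ) / c ^ 2) S (by omega) (by
        intro b hb
        rw [hS, Finset.mem_filter] at hb
        have e : b + (b + c) = c := by rw [← add_assoc, CharTwo.add_self_eq_zero, zero_add]
        have := hint b hb.1 (b + c) hb.2 (by rw [e]; exact hc.1)
        rw [e] at this
        rw [← this]
        congr 1
        ring)
    have hcτ : (c + τ) / c ^ 2 ≠ 0 :=
      div_ne_zero (add_ne_zero_of_ne hc.2) (pow_ne_zero _ hc.1)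
    rw [mul_div_assoc] at h0
    have := (mul_eq_zero.1 h0).resolve_right hcτ
    linear_combination this - v' * two

lemma u_eq {N : ℕ} (hcard : Fintype.card F = 2 ^ N) (hN : 2 ≤ N) (B B' : Finset F)
    (τ u u' v s : F) (hτ : τ ≠ 0) (hvs : v = s + s ^ 2)
    (hn : 4 * Bᶜ.card ^ 2 ≤ 2 ^ N) (hn' : 4 * B'ᶜ.card ^ 2 ≤ 2 ^ N)
    (hint : ∀ b ∈ B, ∀ b' ∈ B', b + b' ≠ 0 →
      tr N ((u + b * v + (u' + b' * v)) * (b + b' + τ) / (b + b') ^ 2) = 0) :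
    u + u' = τ * s ^ 2 ∨ u + u' = τ * s ^ 2 + τ := by
  have two : (2 : F) = 0 := CharTwo.two_eq_zero
  have hq : 4 ≤ 2 ^ N := by
    calc 4 = 2 ^ 2 := by norm_num
      _ ≤ 2 ^ N := Nat.pow_le_pow_right (by norm_num) hN
  have hpow : 2 ^ N = 2 ^ (N - 1) + 2 ^ (N - 1) := by
    obtain ⟨M, rfl⟩ : ∃ M, N = M + 1 := ⟨N - 1, by omega⟩
    simp [pow_succ]; ring
  have h1 : Bᶜ.card ≤ Bᶜ.card ^ 2 := Nat.le_self_pow (by norm_num) _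
  have h1' : B'ᶜ.card ≤ B'ᶜ.card ^ 2 := Nat.le_self_pow (by norm_num) _
  set w := u + u' with hw
  obtain ⟨r, hr⟩ : ∃ r : F, r ^ 2 = w * τ := by
    refine ⟨(w * τ) ^ (2 ^ (N - 1)), ?_⟩
    rw [← pow_mul, ← pow_succ, Nat.sub_add_cancel (by omega), frob hcard]
  have key : ∀ y : F, y ≠ 0 → tr N ((w + v * τ + r) * y + 0) = 0 := by
    intro y hy
    have hm := many hcard B B' (1 / y)
    obtain ⟨b, hb⟩ := Finset.card_pos.1 (by omega : 0 < (B.filter fun b => b + 1 / y ∈ B').card)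
    rw [Finset.mem_filter] at hb
    have e : b + (b + 1 / y) = 1 / y := by
      rw [← add_assoc, CharTwo.add_self_eq_zero, zero_add]
    have := hint b hb.1 _ hb.2 (by rw [e]; exact one_div_ne_zero hy)
    rw [e] at this
    have e2 : (u + b * v + (u' + (b + 1 / y) * v)) * (1 / y + τ) / (1 / y) ^ 2 =
        ((w + v * τ + r) * y + 0) + (r * y + (r * y) ^ 2) + (s + s ^ 2) := by
      rw [mul_pow, hr, ← hvs, hw]
      field_simp
      linear_combination (b * y * v * (1 + y * τ) - r * y) * two
    rw [e2, tr_add, tr_add, tr_artin hcard, tr_artin hcard, add_zero, add_zero] at this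
    exact this
  have h0 := tr_count hcard (by omega) (w + v * τ + r) 0 (Finset.univ.erase 0) (by
    rw [Finset.card_erase_of_mem (Finset.mem_univ _), Finset.card_univ, hcard]
    omega) (fun y hy => key y (Finset.ne_of_mem_erase hy))
  have hrw : r = w + v * τ := by linear_combination h0 - (w + v * τ) * two
  set z := r / τ with hz
  have hrz : r = z * τ := by rw [hz]; field_simp
  have hwz : w = z ^ 2 * τ := by
    apply mul_right_cancel₀ hτ
    rw [← hr, hrz]; ring
  have hzv : z = z ^ 2 + v := by
    apply mul_right_cancel₀ hτ
    rw [← hrz, hrw, hwz]; ring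
  have h2 : (z - s) * (z - s - 1) = 0 := by
    rw [hvs] at hzv
    linear_combination -hzv + (-z * s) * two
  rcases mul_eq_zero.1 h2 with h | h
  · left
    rw [hwz, sub_eq_zero.1 h]; ring
  · right
    have : z = s + 1 := by linear_combination h
    rw [hwz, this]
    linear_combination s * τ * two

lemma assemble {N : ℕ} (hcard : Fintype.card F = 2 ^ N) (hN : 2 ≤ N) (D : Set F)
    (B : F → Finset F) (φ : F → F → F) (hD : ∀ t ∈ D, 4 * (B t)ᶜ.card ^ 2 ≤ 2 ^ N)
    (hint : ∀ t ∈ D, ∀ t' ∈ D, ∀ b ∈ B t, ∀ b' ∈ B t', ∃ x : F,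
      φ t b + b * x + (b + t) * x ^ 2 = φ t' b' + b' * x + (b' + t') * x ^ 2) :
    ∃ s β : F, ∀ t ∈ D, ∀ b ∈ B t, φ t b + b * s + (b + t) * s ^ 2 = β := by
  have two : (2 : F) = 0 := CharTwo.two_eq_zero
  rcases D.eq_empty_or_nonempty with rfl | ⟨t0, ht0⟩
  · exact ⟨0, 0, fun t ht => absurd ht (Set.notMem_empty t)⟩
  have hsing : ∀ t : F, ∃ u v s : F, t ∈ D → v = s + s ^ 2 ∧ ∀ b ∈ B t, φ t b = u + b * v := by
    intro t
    by_cases ht : t ∈ D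
    · obtain ⟨u, v, s, h⟩ := single hcard hN (B t) (φ t) t (hD t ht) (hint t ht t ht)
      exact ⟨u, v, s, fun _ => h⟩
    · exact ⟨0, 0, 0, fun h => absurd h ht⟩
  choose u v σ huv using hsing
  have hpair : ∀ t ∈ D, ∀ t' ∈ D, ∀ b ∈ B t, ∀ b' ∈ B t', b + b' ≠ 0 →
      tr N ((u t + b * v t + (u t' + b' * v t')) * (b + b' + (t + t')) / (b + b') ^ 2) = 0 := by
    intro t ht t' ht' b hb b' hb' hne
    obtain ⟨x, hx⟩ := hint t ht t' ht' b hb b' hb'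
    rw [(huv t ht).2 b hb, (huv t' ht').2 b' hb'] at hx
    refine quad_trace hcard _ _ _ x hne ?_
    linear_combination hx + (u t' + b' * v t' + b' * x + (b' + t') * x ^ 2) * two
  have hv : ∀ t ∈ D, v t = v t0 := by
    intro t ht
    by_cases h : t = t0
    · rw [h]
    · exact v_eq hcard hN (B t) (B t0) (t + t0) (u t) (u t0) _ _ _ _ (add_ne_zero_of_ne h)
        (huv t ht).1 (huv t0 ht0).1 (hD t ht) (hD t0 ht0) (hpair t ht t0 ht0)
  set s := σ t0 with hs
  have hvs : v t0 = s + s ^ 2 := (huv t0 ht0).1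
  have hu : ∀ t ∈ D, ∀ t' ∈ D, u t + u t' = (t + t') * s ^ 2 ∨
      u t + u t' = (t + t') * s ^ 2 + (t + t') := by
    intro t ht t' ht'
    by_cases h : t = t'
    · left
      rw [h]; linear_combination (u t' - t' * s ^ 2) * two
    · refine u_eq hcard hN (B t) (B t') (t + t') (u t) (u t') (v t0) s (add_ne_zero_of_ne h)
        hvs (hD t ht) (hD t' ht') ?_
      have := hpair t ht t' ht'
      rwa [hv t ht, hv t' ht'] at this
  by_cases hc1 : ∀ t ∈ D, u t + t * s ^ 2 = u t0 + t0 * s ^ 2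
  · refine ⟨s, u t0 + t0 * s ^ 2, fun t ht b hb => ?_⟩
    rw [(huv t ht).2 b hb, hv t ht, hvs, ← hc1 t ht]
    linear_combination b * (s + s ^ 2) * two
  by_cases hc2 : ∀ t ∈ D, u t + t * s ^ 2 + t = u t0 + t0 * s ^ 2 + t0
  · refine ⟨s + 1, u t0 + t0 * s ^ 2 + t0, fun t ht b hb => ?_⟩
    rw [(huv t ht).2 b hb, hv t ht, hvs, ← hc2 t ht]
    linear_combination (b * (s ^ 2 + 2 * s + 1) + t * s) * two
  exfalso
  push Not at hc1 hc2
  obtain ⟨t1, ht1, h1⟩ := hc1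
  obtain ⟨t2, ht2, h2⟩ := hc2
  have e1 : u t1 + u t0 = (t1 + t0) * s ^ 2 + (t1 + t0) := by
    refine (hu t1 ht1 t0 ht0).resolve_left fun h => h1 ?_
    linear_combination h + (t1 * s ^ 2 - u t0) * two
  have e2 : u t2 + u t0 = (t2 + t0) * s ^ 2 := by
    refine (hu t2 ht2 t0 ht0).resolve_right fun h => h2 ?_
    linear_combination h + (t2 * s ^ 2 + t2 - u t0) * two
  rcases hu t1 ht1 t2 ht2 with e3 | e3
  · have : t1 = t0 := by
      linear_combination e2 + e3 - e1 - (u t2 - t2 * s ^ 2 + t0) * two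
    exact h1 (by rw [this])
  · have : t2 = t0 := by
      linear_combination -e2 - e3 + e1 + (u t2 - t2 * s ^ 2) * two
    exact h2 (by rw [this])
end Assembly

/-- Let `q > 2` be even and `U` an intersecting family of polynomials over `F_q` of degree at
most `2`. For `t ∈ F_q` let `B_t = {b : ∃ a, a + bx + (b+t)x² ∈ U}` and
`Dom = {t : |B_t| ≥ q − √q/2}`. Then there exist `α, β ∈ F_q` such that every
`g = a + bx + cx² ∈ U` with `b + c ∈ Dom` satisfies `g(α^{q/2}) = β`. -/
theorem stmt17 (F : Type*) [Field F] [Fintype F]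
    (heven : Even (Fintype.card F)) (hq : 2 < Fintype.card F)
    (U : Set (Polynomial F)) (hdeg : ∀ f ∈ U, f.natDegree ≤ 2)
    (hint : ∀ f ∈ U, ∀ g ∈ U, ∃ x : F, f.eval x = g.eval x)
    (Dom : Set F)
    (hDom : Dom = {t : F |
      (Fintype.card F : ℝ) - Real.sqrt (Fintype.card F) / 2 ≤
        ({b : F | ∃ a : F, C a + C b * X + C (b + t) * X ^ 2 ∈ U}.ncard : ℝ)}) :
    ∃ α β : F, ∀ a b c : F, b + c ∈ Dom →
      C a + C b * X + C c * X ^ 2 ∈ U →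
        (C a + C b * X + C c * X ^ 2 : Polynomial F).eval
          (α ^ (Fintype.card F / 2)) = β := by
  classical
  obtain ⟨p, hp⟩ := CharP.exists F
  obtain ⟨n, hprime, hcard0⟩ := FiniteField.card F p
  have hp2 : p = 2 := by
    have h2 : 2 ∣ p ^ (n : ℕ) := by rw [← hcard0]; exact heven.two_dvd
    exact ((Nat.prime_dvd_prime_iff_eq Nat.prime_two hprime).1
      (Nat.prime_two.dvd_of_dvd_pow h2)).symm
  subst hp2
  obtain ⟨N, hN0⟩ : ∃ N : ℕ, N = (n : ℕ) := ⟨_, rfl⟩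
  rw [← hN0] at hcard0
  have hcard : Fintype.card F = 2 ^ N := hcard0
  have hN : 2 ≤ N := by
    by_contra hcon
    have h1 : N ≤ 1 := by omega
    have h2 : 2 ^ N ≤ 2 ^ 1 := Nat.pow_le_pow_right (by norm_num) h1
    omega
  have two : (2 : F) = 0 := CharTwo.two_eq_zero
  let P : F → F → Prop := fun t b => ∃ a : F, C a + C b * X + C (b + t) * X ^ 2 ∈ U
  let B : F → Finset F := fun t => Finset.univ.filter (P t)
  let φ : F → F → F := fun t b => if h : P t b then h.choose else 0
  have hφ : ∀ t b, P t b → C (φ t b) + C b * X + C (b + t) * X ^ 2 ∈ U := by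
    intro t b h
    have e : φ t b = h.choose := dif_pos h
    rw [e]
    exact h.choose_spec
  have hB : ∀ t b, b ∈ B t → P t b := fun t b h => (Finset.mem_filter.1 h).2
  have hD : ∀ t ∈ Dom, 4 * (B t)ᶜ.card ^ 2 ≤ 2 ^ N := by
    intro t ht
    rw [hDom, Set.mem_setOf_eq] at ht
    have e : {b : F | ∃ a : F, C a + C b * X + C (b + t) * X ^ 2 ∈ U} = (B t : Set F) := by
      ext b
      simp [B, P]
    rw [e, Set.ncard_coe_finset] at ht
    have hsum : ((B t).card : ℝ) + ((B t)ᶜ.card : ℝ) = (Fintype.card F : ℝ) := by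
      exact_mod_cast Finset.card_add_card_compl (B t)
    have hs := Real.sq_sqrt (Nat.cast_nonneg (α := ℝ) (Fintype.card F))
    have hs0 := Real.sqrt_nonneg (Fintype.card F : ℝ)
    have hc0 : (0 : ℝ) ≤ ((B t)ᶜ.card : ℝ) := Nat.cast_nonneg _
    have h1 : 2 * ((B t)ᶜ.card : ℝ) ≤ Real.sqrt (Fintype.card F) := by linarith
    have h2 : 4 * ((B t)ᶜ.card : ℝ) ^ 2 ≤ (Fintype.card F : ℝ) := by
      rw [← hs]; nlinarith
    rw [← hcard]
    exact_mod_cast h2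
  obtain ⟨s, β, hsβ⟩ := assemble hcard hN Dom B φ hD (by
    intro t ht t' ht' b hb b' hb'
    obtain ⟨x, hx⟩ := hint _ (hφ t b (hB t b hb)) _ (hφ t' b' (hB t' b' hb'))
    refine ⟨x, ?_⟩
    simpa using hx)
  refine ⟨s ^ 2, β, fun a b c hbc hU => ?_⟩
  have hroot : (s ^ 2) ^ (Fintype.card F / 2) = s := by
    rw [← pow_mul, Nat.mul_div_cancel' heven.two_dvd, FiniteField.pow_card]
  have hc : b + (b + c) = c := by linear_combination b * two
  have hP : P (b + c) b := ⟨a, by rw [hc]; exact hU⟩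
  have ha : a = φ (b + c) b := by
    obtain ⟨x, hx⟩ := hint _ hU _ (hφ _ _ hP)
    rw [hc] at hx
    simpa using hx
  have h := hsβ (b + c) hbc b (Finset.mem_filter.2 ⟨Finset.mem_univ _, hP⟩)
  rw [hc, ← ha] at h
  rw [hroot]
  simpa using h
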